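/- arXiv:1904.09070 — 4 statements merged into one kernel-verified Lean document; each statement's English description precedes it below -/
import Mathlib

section
/- For every real number n > 0, the identity Φ₁(n) = √(2/n)·Ψ₁(1/n) + Ψ₁(n) holds, where Φ₁(a) = ∫₀^∞ cos(π a x²)/cosh(π x) dx and Ψ₁(a) = ∫₀^∞ sin(π a x²)/cosh(π x) dx. -/
open Real MeasureTheory

noncomputable def Phi1 (a : ℝ) : ℝ :=
  ∫ x in Set.Ioi (0:ℝ), Real.cos (π * a * x ^ 2) / Real.cosh (π * x)

noncomputable def Psi1 (a : ℝ) : ℝ :=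
  ∫ x in Set.Ioi (0:ℝ), Real.sin (π * a * x ^ 2) / Real.cosh (π * x)

lemma sig1 (x : ℝ) : Real.sigmoid (2*π*x) = Real.exp (π*x - Real.log (2*Real.cosh (π*x))) := by
  have hc := Real.cosh_pos (π*x)
  rw [Real.exp_sub, Real.exp_log (by positivity), Real.sigmoid_def, Real.cosh_eq, Real.exp_neg, Real.exp_neg,
    show 2*π*x = π*x+π*x by ring, Real.exp_add]
  have := Real.exp_pos (π*x)
  field_simp

lemma sig2 (x : ℝ) : 1 - Real.sigmoid (2*π*x) = Real.exp (-(π*x) - Real.log (2*Real.cosh (π*x))) := by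
  rw [← Real.sigmoid_neg]
  have := sig1 (-x)
  simpa [Real.cosh_neg] using this

lemma cexp_cpow (a : ℝ) (s : ℂ) : ((Real.exp a : ℝ) : ℂ) ^ s = Complex.exp (a * s) := by
  rw [Complex.cpow_def_of_ne_zero (by exact_mod_cast (Real.exp_pos a).ne'), ← Complex.ofReal_log (Real.exp_pos a).le, Real.log_exp]

lemma sech_ft (y : ℝ) : ∫ x : ℝ, Complex.exp (2*π*Complex.I*x*y) * (1/Real.cosh (π*x) : ℝ) = (1/Real.cosh (π*y) : ℝ) := by
  set s : ℂ := 1/2 + Complex.I*y with hs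
  have hre : s.re = 1/2 := by simp [hs]
  have h1 := Complex.Gamma_mul_Gamma_eq_betaIntegral (s := s) (t := 1 - s) (by rw [hre]; norm_num)
    (by simp [hre]; norm_num)
  rw [Complex.Gamma_mul_Gamma_one_sub, add_sub_cancel, Complex.Gamma_one, one_mul,
    Complex.betaIntegral, intervalIntegral.integral_of_le zero_le_one, integral_Ioc_eq_integral_Ioo] at h1
  have himg : (fun x : ℝ => Real.sigmoid (2*π*x)) '' Set.univ = Set.Ioo 0 1 := by
    rw [← Real.range_sigmoid, Set.image_univ]
    ext z; constructor
    · rintro ⟨x, rfl⟩; exact ⟨_, rfl⟩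
    · rintro ⟨x, rfl⟩; exact ⟨x/(2*π), by simp only; congr 1; field_simp⟩
  rw [← himg, integral_image_eq_integral_abs_deriv_smul (f' := fun x => Real.sigmoid (2*π*x) * (1 - Real.sigmoid (2*π*x)) * (2*π)) MeasurableSet.univ] at h1
  rotate_left
  · intro x _
    have h := (Real.hasDerivAt_sigmoid (2*π*x)).comp x ((hasDerivAt_id x).const_mul (2*π))
    have h' := h.hasDerivWithinAt (s := Set.univ)
    rw [mul_one] at h'
    exact h'
  · intro a _ b _ h
    have := Real.sigmoid_injective h
    have hp := Real.pi_pos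
    exact mul_left_cancel₀ (by positivity) this
  rw [Measure.restrict_univ] at h1
  have h2 : ∀ x : ℝ, |Real.sigmoid (2*π*x) * (1 - Real.sigmoid (2*π*x)) * (2*π)| • ((Real.sigmoid (2*π*x) : ℂ) ^ (s-1) * (1 - (Real.sigmoid (2*π*x) : ℂ)) ^ (1 - s - 1)) = π * (Complex.exp (2*π*Complex.I*x*y) * (1/Real.cosh (π*x) : ℝ)) := by
    intro x
    have hc := Real.cosh_pos (π*x)
    have : 1 - (Real.sigmoid (2*π*x) : ℂ) = ((1 - Real.sigmoid (2*π*x) : ℝ) : ℂ) := by push_cast; rfl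
    rw [this, sig2, sig1, cexp_cpow, cexp_cpow, abs_of_nonneg (by positivity), Complex.real_smul]
    have e : (1/Real.cosh (π*x)) = 2 * Real.exp (- Real.log (2*Real.cosh (π*x))) := by
      rw [Real.exp_neg, Real.exp_log (by positivity)]; field_simp
    rw [e]
    set L := Real.log (2*Real.cosh (π*x))
    push_cast
    have : ∀ a b c d : ℂ, Complex.exp a * Complex.exp b * (2*π) * (Complex.exp c * Complex.exp d) = 2*π * Complex.exp (a+b+c+d) := by
      intros; simp only [Complex.exp_add]; ring
    rw [this]
    have : ∀ a b : ℂ, π * (Complex.exp a * (2 * Complex.exp b)) = 2*π * Complex.exp (a+b) := by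
      intros; simp only [Complex.exp_add]; ring
    rw [this]
    congr 2
    rw [hs]; ring
  simp_rw [h2] at h1
  rw [integral_const_mul] at h1
  have h3 : Complex.sin (π * s) = Complex.cosh (π*y) := by
    rw [hs, ← Complex.cos_mul_I, ← Complex.sin_add_pi_div_two]; congr 1; ring
  rw [h3] at h1
  have hp : (π:ℂ) ≠ 0 := by exact_mod_cast Real.pi_ne_zero
  apply mul_left_cancel₀ hp
  rw [← h1]; push_cast; ring

lemma sech_int : Integrable (fun x : ℝ => 1/Real.cosh (π*x)) := by
  refine integrable_inv_one_add_sq.mono' (by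
    have : ∀ x:ℝ, Real.cosh (π*x) ≠ 0 := fun x => (Real.cosh_pos _).ne'
    exact (Continuous.div continuous_const (by fun_prop) this).aestronglyMeasurable) ?_
  refine Filter.Eventually.of_forall fun x => ?_
  have hc := Real.cosh_pos (π*x)
  rw [Real.norm_of_nonneg (by positivity), one_div]
  apply inv_anti₀ (by positivity)
  have h := Real.quadratic_le_exp_of_nonneg (x := |π*x|) (abs_nonneg _)
  have h' := Real.add_one_le_exp (-|π*x|)
  rw [← Real.cosh_abs, Real.cosh_eq]
  rw [sq_abs] at h
  have : 4 * x^2 ≤ (π*x)^2 := by nlinarith [Real.pi_gt_three, sq_nonneg x, mul_nonneg (sq_nonneg x) (by nlinarith [Real.pi_gt_three] : 0 ≤ π^2-4)]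
  nlinarith

lemma sechC_int : Integrable (fun x : ℝ => ((1/Real.cosh (π*x) : ℝ) : ℂ)) := sech_int.ofReal

open FourierTransform in
lemma sech_fourier (y : ℝ) : 𝓕 (fun x : ℝ => ((1/Real.cosh (π*x) : ℝ) : ℂ)) y = (1/Real.cosh (π*y) : ℝ) := by
  rw [Real.fourier_real_eq_integral_exp_smul]
  have h := sech_ft (-y)
  rw [show π * -y = -(π*y) by ring, Real.cosh_neg] at h
  rw [← h]
  congr 1
  ext x
  rw [smul_eq_mul]
  congr 2
  push_cast; ring

open FourierTransform in
lemma parseval (b : ℂ) (hb : 0 < b.re) :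
    1 / b ^ (1 / 2 : ℂ) * ∫ x : ℝ, Complex.exp (-π / b * x ^ 2) * (1/Real.cosh (π*x) : ℝ) =
    ∫ x : ℝ, Complex.exp (-π * b * x ^ 2) * (1/Real.cosh (π*x) : ℝ) := by
  have hi : Integrable (fun x : ℝ => Complex.exp (-π * b * x ^ 2)) := by
    have := integrable_cexp_neg_mul_sq (b := π * b) (by simpa using mul_pos Real.pi_pos hb)
    simpa [neg_mul] using this
  have h := VectorFourier.integral_fourierIntegral_smul_eq_flip (L := innerₗ ℝ) (μ := volume) (ν := volume)
      Real.continuous_fourierChar continuous_inner hi sechC_int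
  have e1 : ∀ y : ℝ, VectorFourier.fourierIntegral Real.fourierChar volume (innerₗ ℝ) (fun x : ℝ => Complex.exp (-π * b * x ^ 2)) y = 1 / b ^ (1 / 2 : ℂ) * Complex.exp (-π / b * y ^ 2) := 
    fun y => congrFun (fourier_gaussian_pi hb) y
  have e2 : ∀ y : ℝ, VectorFourier.fourierIntegral Real.fourierChar volume (innerₗ ℝ).flip (fun x : ℝ => ((1/Real.cosh (π*x) : ℝ) : ℂ)) y = (1/Real.cosh (π*y) : ℝ) := by
    intro y
    rw [flip_innerₗ]
    exact sech_fourier y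
  simp_rw [e1, e2, smul_eq_mul, mul_assoc] at h
  rw [integral_const_mul] at h
  simpa only [mul_assoc] using h

lemma tends (c : ℝ → ℂ) (c0 : ℂ) (hc : Filter.Tendsto c (nhdsWithin 0 (Set.Ioi 0)) (nhds c0))
    (hre : ∀ e > 0, (c e).re ≤ 0) :
    Filter.Tendsto (fun e => ∫ x : ℝ, Complex.exp (c e * x ^ 2) * (1/Real.cosh (π*x) : ℝ))
      (nhdsWithin 0 (Set.Ioi 0)) (nhds (∫ x : ℝ, Complex.exp (c0 * x ^ 2) * (1/Real.cosh (π*x) : ℝ))) := by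
  apply tendsto_integral_filter_of_dominated_convergence (fun x : ℝ => 1/Real.cosh (π*x))
  · refine Filter.Eventually.of_forall fun e => ?_
    exact AEStronglyMeasurable.mul (by fun_prop) sechC_int.aestronglyMeasurable
  · filter_upwards [self_mem_nhdsWithin] with e he
    refine Filter.Eventually.of_forall fun x => ?_
    have hp := Real.cosh_pos (π*x)
    rw [norm_mul, Complex.norm_real, Real.norm_of_nonneg (by positivity), Complex.norm_exp]
    have : (c e * (x:ℂ)^2).re ≤ 0 := by
      rw [← Complex.ofReal_pow, Complex.re_mul_ofReal]
      exact mul_nonpos_of_nonpos_of_nonneg (hre e he) (sq_nonneg x)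
    exact mul_le_of_le_one_left (by positivity) (Real.exp_le_one_iff.mpr this)
  · exact sech_int
  · refine Filter.Eventually.of_forall fun x => ?_
    exact ((Complex.continuous_exp.tendsto _).comp (hc.mul_const _)).mul_const _

lemma G_eq (a : ℝ) : ∫ x : ℝ, Complex.exp (π * a * Complex.I * x ^ 2) * (1/Real.cosh (π*x) : ℝ)
    = 2 * ((Phi1 a : ℂ) + Psi1 a * Complex.I) := by
  have key : ∀ x : ℝ, Complex.exp (π * a * Complex.I * x ^ 2) * (1/Real.cosh (π*x) : ℝ)
      = ((Real.cos (π*a*x^2) / Real.cosh (π*x) : ℝ) : ℂ) + ((Real.sin (π*a*x^2) / Real.cosh (π*x) : ℝ) : ℂ) * Complex.I := by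
    intro x
    rw [show (π * a * Complex.I * x ^ 2 : ℂ) = ((π*a*x^2 : ℝ) : ℂ) * Complex.I by push_cast; ring, Complex.exp_mul_I]
    push_cast; ring
  have i1 : Integrable (fun x : ℝ => Real.cos (π*a*x^2) / Real.cosh (π*x)) := by
    have := sech_int.bdd_mul (f := fun x : ℝ => Real.cos (π*a*x^2)) (c := 1) (by fun_prop)
      (Filter.Eventually.of_forall fun x => Real.abs_cos_le_one _)
    simpa [div_eq_mul_inv] using this
  have i2 : Integrable (fun x : ℝ => Real.sin (π*a*x^2) / Real.cosh (π*x)) := by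
    have := sech_int.bdd_mul (f := fun x : ℝ => Real.sin (π*a*x^2)) (c := 1) (by fun_prop)
      (Filter.Eventually.of_forall fun x => Real.abs_sin_le_one _)
    simpa [div_eq_mul_inv] using this
  have hx : ∀ x : ℝ, Real.cosh (π*|x|) = Real.cosh (π*x) := by
    intro x
    rw [← Real.cosh_abs (π*x), abs_mul, abs_of_pos Real.pi_pos]
  have j1 := integral_comp_abs (f := fun x : ℝ => Real.cos (π*a*x^2) / Real.cosh (π*x))
  have j2 := integral_comp_abs (f := fun x : ℝ => Real.sin (π*a*x^2) / Real.cosh (π*x))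
  simp only [hx, sq_abs] at j1 j2
  simp_rw [key]
  rw [integral_add i1.ofReal (i2.ofReal.mul_const _), integral_mul_const, integral_complex_ofReal,
    integral_complex_ofReal, j1, j2, Phi1, Psi1]
  push_cast; ring

lemma Phi1_neg (a : ℝ) : Phi1 (-a) = Phi1 a := by
  simp [Phi1]

lemma Psi1_neg (a : ℝ) : Psi1 (-a) = - Psi1 a := by
  simp [Psi1, neg_div, integral_neg]

lemma sqrt_I (n : ℝ) (hn : 0 < n) : ((n : ℂ) * Complex.I) ^ (1 / 2 : ℂ) = Real.sqrt n * ((1 + Complex.I) / Real.sqrt 2) := by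
  have h0 : ((n : ℂ) * Complex.I) ≠ 0 := mul_ne_zero (by exact_mod_cast hn.ne') Complex.I_ne_zero
  rw [Complex.cpow_def_of_ne_zero h0, Complex.log_ofReal_mul hn Complex.I_ne_zero, Complex.log_I, add_mul, Complex.exp_add]
  congr 1
  · rw [Real.sqrt_eq_rpow, Real.rpow_def_of_pos hn]; push_cast; rfl
  · rw [show (π / 2 * Complex.I * (1/2) : ℂ) = ((π/4 : ℝ) : ℂ) * Complex.I by push_cast; ring, Complex.exp_mul_I,
      ← Complex.ofReal_cos, ← Complex.ofReal_sin, Real.cos_pi_div_four, Real.sin_pi_div_four]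
    have h2 : ((Real.sqrt 2 : ℝ) : ℂ) ^ 2 = 2 := by rw [← Complex.ofReal_pow, Real.sq_sqrt (by norm_num)]; norm_num
    have h3 : ((Real.sqrt 2 : ℝ) : ℂ) ≠ 0 := by intro h; rw [h] at h2; norm_num at h2
    push_cast
    field_simp
    rw [h2]

lemma main_eq (n : ℝ) (hn : 0 < n) :
    1 / ((n : ℂ) * Complex.I) ^ (1 / 2 : ℂ) * (2 * ((Phi1 (1/n) : ℂ) + Psi1 (1/n) * Complex.I))
     = 2 * ((Phi1 n : ℂ) - Psi1 n * Complex.I) := by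
  have h0 : ((n : ℂ) * Complex.I) ≠ 0 := mul_ne_zero (by exact_mod_cast hn.ne') Complex.I_ne_zero
  have hb : Filter.Tendsto (fun e : ℝ => (e : ℂ) + n * Complex.I) (nhdsWithin 0 (Set.Ioi 0)) (nhds (n * Complex.I)) := by
    have : Continuous (fun e : ℝ => (e : ℂ) + n * Complex.I) := by fun_prop
    have := this.tendsto 0
    simp only [Complex.ofReal_zero, zero_add] at this
    exact this.mono_left nhdsWithin_le_nhds
  have t1 := tends (fun e => -π / ((e : ℂ) + n * Complex.I)) _ (tendsto_const_nhds.div hb h0) (by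
    intro e he
    rw [Complex.div_re]
    have : 0 < π := Real.pi_pos
    have hq : (-(π:ℂ)).re * ((e : ℂ) + n * Complex.I).re = -(π * e) := by simp
    have hq2 : (-(π:ℂ)).im = 0 := by simp
    rw [hq, hq2, zero_mul, zero_div, add_zero]
    exact div_nonpos_of_nonpos_of_nonneg (by have := mul_pos this he; linarith) (Complex.normSq_nonneg _))
  have t2 := tends (fun e => -π * ((e : ℂ) + n * Complex.I)) _ (hb.const_mul _) (by
    intro e he
    have : 0 < π := Real.pi_pos
    have hq : (-(π:ℂ) * ((e : ℂ) + n * Complex.I)).re = -(π * e) := by simp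
    rw [hq]
    have := mul_pos this he
    linarith)
  have t3 : Filter.Tendsto (fun e : ℝ => 1 / ((e : ℂ) + n * Complex.I) ^ (1 / 2 : ℂ)) (nhdsWithin 0 (Set.Ioi 0)) (nhds (1 / ((n : ℂ) * Complex.I) ^ (1 / 2 : ℂ))) := by
    refine Filter.Tendsto.div tendsto_const_nhds ?_ ?_
    · exact hb.cpow tendsto_const_nhds (by right; simpa using hn.ne')
    · simp [Complex.cpow_eq_zero_iff, hn.ne']
  have t4 := t3.mul t1
  have hu := tendsto_nhds_unique_of_eventuallyEq t4 t2 (by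
    filter_upwards [self_mem_nhdsWithin] with e he
    exact parseval _ (by simpa using he))
  have g1 := G_eq (1/n)
  have g2 := G_eq (-n)
  rw [Phi1_neg, Psi1_neg] at g2
  rw [← g1]
  have : (2 * ((Phi1 n : ℂ) - Psi1 n * Complex.I)) = 2 * ((Phi1 n : ℂ) + (-Psi1 n : ℝ) * Complex.I) := by push_cast; ring
  rw [this, ← g2]
  have c1 : (π * (1/n : ℝ) * Complex.I : ℂ) = -π / (n * Complex.I) := by
    have : (n : ℂ) ≠ 0 := by exact_mod_cast hn.ne'
    have := Complex.I_ne_zero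
    push_cast
    field_simp
    rw [Complex.I_sq]
  have c2 : (π * (-n : ℝ) * Complex.I : ℂ) = -π * (n * Complex.I) := by push_cast; ring
  rw [c1, c2]
  exact hu

theorem stmt0 (n : ℝ) (hn : 0 < n) :
    Phi1 n = Real.sqrt (2 / n) * Psi1 (1 / n) + Psi1 n := by
  have h := main_eq n hn
  have h0 : ((n : ℂ) * Complex.I) ^ (1 / 2 : ℂ) ≠ 0 := by
    simp [Complex.cpow_eq_zero_iff, hn.ne']
  have hs : 0 < Real.sqrt n := Real.sqrt_pos.mpr hn
  have h2 : 0 < Real.sqrt 2 := by positivity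
  have h22 : Real.sqrt 2 * Real.sqrt 2 = 2 := Real.mul_self_sqrt (by norm_num)
  have h2c : ((Real.sqrt 2 : ℝ) : ℂ) ≠ 0 := by exact_mod_cast h2.ne'
  rw [one_div, inv_mul_eq_iff_eq_mul₀ h0, sqrt_I n hn] at h
  have h' : (Real.sqrt 2 : ℂ) * ((Phi1 (1/n) : ℂ) + Psi1 (1/n) * Complex.I) = Real.sqrt n * (1 + Complex.I) * ((Phi1 n : ℂ) - Psi1 n * Complex.I) := by
    field_simp at h
    linear_combination h
  have him := congrArg Complex.im h'
  simp at him
  rw [Real.sqrt_div (by norm_num)]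
  field_simp
  rw [one_div]
  linarith
end

section
/- For every real number n > 0, the identity Ψ₁(n) = √(2/n)·Φ₁(1/n) − Φ₁(n) holds, where Φ₁(a) = ∫₀^∞ cos(π a x²)/cosh(π x) dx and Ψ₁(a) = ∫₀^∞ sin(π a x²)/cosh(π x) dx. -/
open Real MeasureTheory

open scoped FourierTransform in
theorem sech_fourier_beta (ξ : ℝ) :
    ∫ x : ℝ, Complex.exp (↑(-2 * π * x * ξ) * Complex.I) • ((1 / Real.cosh (π * x) : ℝ) : ℂ)
      = ((1 / Real.cosh (π * ξ) : ℝ) : ℂ) := by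
  set u : ℂ := 1 / 2 - Complex.I * ξ with hu
  have hv : 1 - u = 1 / 2 + Complex.I * ξ := by rw [hu]; ring
  have h1 : Complex.betaIntegral u (1 - u) = π / Complex.sin (π * u) := by
    have := Complex.Gamma_mul_Gamma_eq_betaIntegral (s := u) (t := 1 - u)
      (by simp [hu]) (by simp [hv])
    rw [Complex.Gamma_mul_Gamma_one_sub, show u + (1 - u) = 1 by ring, Complex.Gamma_one,
      one_mul] at this
    exact this.symm
  have h2 : Complex.sin (π * u) = ((Real.cosh (π * ξ) : ℝ) : ℂ) := by
    rw [hu, show (π : ℂ) * (1 / 2 - Complex.I * ξ) = π / 2 - (π * ξ) * Complex.I by ring,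
      Complex.sin_pi_div_two_sub, Complex.cos_mul_I]
    push_cast; rfl
  have h3 : Complex.betaIntegral u (1 - u) = ∫ x : ℝ, (π : ℂ) *
      (Complex.exp (↑(-2 * π * x * ξ) * Complex.I) • ((1 / Real.cosh (π * x) : ℝ) : ℂ)) := by
    rw [Complex.betaIntegral, intervalIntegral.integral_of_le zero_le_one,
      integral_Ioc_eq_integral_Ioo]
    have him : (fun x : ℝ => Real.sigmoid (2 * π * x)) '' Set.univ = Set.Ioo 0 1 := by
      rw [Set.image_univ, ← Real.range_sigmoid]
      refine Function.Surjective.range_comp (f := fun x : ℝ => 2 * π * x) (fun y => ⟨y / (2 * π), ?_⟩)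
        Real.sigmoid
      have := Real.pi_ne_zero
      field_simp
    rw [← him, integral_image_eq_integral_abs_deriv_smul MeasurableSet.univ
      (f' := fun x => Real.sigmoid (2 * π * x) * (1 - Real.sigmoid (2 * π * x)) * (2 * π))]
    · rw [setIntegral_univ]
      congr 1
      ext x
      have hc : 0 < Real.cosh (π * x) := Real.cosh_pos _
      set L : ℝ := Real.log (2 * Real.cosh (π * x)) with hL
      have heL : Real.exp L = 2 * Real.cosh (π * x) := Real.exp_log (by positivity)
      have hs : Real.sigmoid (2 * π * x) = Real.exp (π * x - L) := by
        rw [Real.exp_sub, heL, Real.sigmoid_def, Real.cosh_eq,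
          show -(2 * π * x) = -(π * x) + -(π * x) by ring, Real.exp_add, Real.exp_neg]
        have := Real.exp_pos (π * x)
        field_simp
      have hs' : 1 - Real.sigmoid (2 * π * x) = Real.exp (-(π * x) - L) := by
        rw [← Real.sigmoid_neg, Real.exp_sub, heL, Real.sigmoid_def, Real.cosh_eq,
          show -(-(2 * π * x)) = (π * x) + (π * x) by ring, Real.exp_add, Real.exp_neg]
        have := Real.exp_pos (π * x)
        field_simp
        ring
      have hcp : ∀ (r : ℝ) (w : ℂ), ((Real.exp r : ℝ) : ℂ) ^ w = Complex.exp (r * w) := by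
        intro r w
        rw [Complex.cpow_def_of_ne_zero (by exact_mod_cast (Real.exp_pos r).ne'),
          ← Complex.ofReal_log (Real.exp_pos r).le, Real.log_exp]
      have hs'' : (1 : ℂ) - (Real.sigmoid (2 * π * x) : ℝ) = ((Real.exp (-(π * x) - L) : ℝ) : ℂ) := by
        rw [← hs']; push_cast; rfl
      rw [hs'', hs', hs, abs_of_pos (by positivity), hcp, hcp]
      have hsech : ((1 / Real.cosh (π * x) : ℝ) : ℂ) = 2 * Complex.exp (-L) := by
        have : (1 / Real.cosh (π * x) : ℝ) = 2 * Real.exp (-L) := by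
          rw [Real.exp_neg, heL]; field_simp
        rw [this]; push_cast; rfl
      rw [hsech, Complex.real_smul, smul_eq_mul]
      push_cast
      have e : ∀ A B C D E F : ℂ, A + B + (C + D) = E + F →
          Complex.exp A * Complex.exp B * (2 * π) * (Complex.exp C * Complex.exp D) =
          π * (Complex.exp E * (2 * Complex.exp F)) := by
        intro A B C D E F h
        have : Complex.exp A * Complex.exp B * (Complex.exp C * Complex.exp D) =
          Complex.exp E * Complex.exp F := by
          rw [← Complex.exp_add, ← Complex.exp_add, ← Complex.exp_add, ← Complex.exp_add, h]
        linear_combination (2 * π) * this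
      apply e
      rw [hv, hu]
      ring
    · intro x _
      have := (Real.hasDerivAt_sigmoid (2 * π * x)).comp x ((hasDerivAt_id x).const_mul (2 * π))
      have h' := this.hasDerivWithinAt (s := Set.univ)
      rw [mul_one] at h'
      exact h'
    · intro x _ y _ h
      have := Real.sigmoid_injective h
      have := Real.pi_pos
      simp_all
  rw [h1, h2, integral_const_mul] at h3
  have hp : (π : ℂ) ≠ 0 := by exact_mod_cast Real.pi_ne_zero
  apply mul_left_cancel₀ hp
  rw [← h3]
  push_cast
  ring

theorem sech_integrable : Integrable (fun x : ℝ => ((1 / Real.cosh (π * x) : ℝ) : ℂ)) := by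
  by_contra h
  have := sech_fourier_beta 0
  simp only [mul_zero, Complex.ofReal_zero, zero_mul, Complex.exp_zero, one_smul] at this
  rw [integral_undef h] at this
  simp at this

noncomputable def JJ (b : ℂ) : ℂ :=
  ∫ x : ℝ, Complex.exp (-π * b * x ^ 2) * ((1 / Real.cosh (π * x) : ℝ) : ℂ)

theorem norm_gauss_le (b : ℂ) (hb : 0 ≤ b.re) (x : ℝ) :
    ‖Complex.exp (-π * b * x ^ 2)‖ ≤ 1 := by
  rw [Complex.norm_exp]
  have : (-π * b * x ^ 2 : ℂ).re = - (π * b.re * x ^ 2) := by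
    rw [show (-π * b * x ^ 2 : ℂ) = ((-π * x ^ 2 : ℝ) : ℂ) * b by push_cast; ring,
      Complex.re_ofReal_mul]
    ring
  rw [this, Real.exp_le_one_iff]
  have := Real.pi_pos
  have : 0 ≤ π * b.re * x ^ 2 := by positivity
  linarith

theorem cont_sech : Continuous (fun x : ℝ => ((1 / Real.cosh (π * x) : ℝ) : ℂ)) := by
  apply Complex.continuous_ofReal.comp
  apply Continuous.div continuous_const (by fun_prop)
  intro x; exact (Real.cosh_pos _).ne'

theorem JJ_integrable (b : ℂ) (hb : 0 ≤ b.re) :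
    Integrable (fun x : ℝ => Complex.exp (-π * b * x ^ 2) * ((1 / Real.cosh (π * x) : ℝ) : ℂ)) := by
  apply sech_integrable.mono
  · exact (Continuous.mul (by fun_prop) cont_sech).aestronglyMeasurable
  · refine Filter.Eventually.of_forall fun x => ?_
    rw [norm_mul]
    exact mul_le_of_le_one_left (norm_nonneg _) (norm_gauss_le b hb x)

open scoped FourierTransform in
theorem JJ_funct (b : ℂ) (hb : 0 < b.re) : JJ b = 1 / b ^ (1 / 2 : ℂ) * JJ (1 / b) := by
  have hf : Integrable (fun x : ℝ => Complex.exp (-π * b * x ^ 2)) := by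
    have := integrable_cexp_neg_mul_sq (b := π * b)
      (by rw [Complex.re_ofReal_mul]; exact mul_pos Real.pi_pos hb)
    simpa using this
  have key : ∫ ξ : ℝ, (𝓕 fun x : ℝ => Complex.exp (-π * b * x ^ 2)) ξ •
        ((1 / Real.cosh (π * ξ) : ℝ) : ℂ) =
      ∫ x : ℝ, Complex.exp (-π * b * x ^ 2) •
        (𝓕 (fun x : ℝ => ((1 / Real.cosh (π * x) : ℝ) : ℂ))) x := by
    simpa using! VectorFourier.integral_fourierIntegral_smul_eq_flip (L := innerₗ ℝ)
      Real.continuous_fourierChar continuous_inner hf sech_integrable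
  have hF : (𝓕 (fun x : ℝ => ((1 / Real.cosh (π * x) : ℝ) : ℂ))) =
      (fun x : ℝ => ((1 / Real.cosh (π * x) : ℝ) : ℂ)) := by
    ext ξ
    rw [Real.fourier_real_eq_integral_exp_smul, sech_fourier_beta]
  rw [fourier_gaussian_pi hb, hF] at key
  simp only [smul_eq_mul] at key
  rw [JJ, ← key, JJ, ← integral_const_mul]
  congr 1
  ext x
  rw [show (-π * (1 / b) * x ^ 2 : ℂ) = -π / b * x ^ 2 by ring]
  ring

theorem JJ_tendsto (f : ℝ → ℂ) (b : ℂ) (hf : Filter.Tendsto f (nhdsWithin 0 (Set.Ioi 0)) (nhds b))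
    (hp : ∀ᶠ ε in nhdsWithin (0:ℝ) (Set.Ioi 0), 0 ≤ (f ε).re) :
    Filter.Tendsto (fun ε => JJ (f ε)) (nhdsWithin 0 (Set.Ioi 0)) (nhds (JJ b)) := by
  apply tendsto_integral_filter_of_dominated_convergence
    (fun x : ℝ => ‖((1 / Real.cosh (π * x) : ℝ) : ℂ)‖)
  · exact Filter.Eventually.of_forall fun ε =>
      (Continuous.mul (by fun_prop) cont_sech).aestronglyMeasurable
  · filter_upwards [hp] with ε hε
    refine Filter.Eventually.of_forall fun x => ?_
    rw [norm_mul]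
    exact mul_le_of_le_one_left (norm_nonneg _) (norm_gauss_le _ hε x)
  · exact sech_integrable.norm
  · refine Filter.Eventually.of_forall fun x => ?_
    apply Filter.Tendsto.mul_const
    exact (Complex.continuous_exp.tendsto _).comp ((hf.const_mul _).mul_const _)

theorem JJ_funct_I (n : ℝ) (hn : 0 < n) :
    JJ (-(n * Complex.I)) = 1 / (-(n * Complex.I)) ^ (1 / 2 : ℂ) * JJ ((1 / n : ℝ) * Complex.I) := by
  have hn' : (n : ℂ) ≠ 0 := by exact_mod_cast hn.ne'
  have hne : (-(n * Complex.I)) ≠ 0 := by simp [hn']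
  have hinv : ((1 / n : ℝ) * Complex.I) = 1 / (-(n * Complex.I)) := by
    push_cast
    field_simp
    simp
  have hmem : ∀ᶠ ε in nhdsWithin (0:ℝ) (Set.Ioi 0), 0 < ε := self_mem_nhdsWithin
  have t0 : Filter.Tendsto (fun ε : ℝ => (ε : ℂ) - n * Complex.I) (nhdsWithin 0 (Set.Ioi 0))
      (nhds (-(n * Complex.I))) := by
    have : Continuous (fun ε : ℝ => (ε : ℂ) - n * Complex.I) := by fun_prop
    have := (this.tendsto 0).mono_left (nhdsWithin_le_nhds (s := Set.Ioi 0))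
    simpa using this
  have hre : ∀ ε : ℝ, ((ε : ℂ) - n * Complex.I).re = ε := by intro ε; simp
  have t1 := JJ_tendsto _ _ t0 (by filter_upwards [hmem] with ε h; rw [hre]; exact h.le)
  have t2 := JJ_tendsto _ _ (Filter.Tendsto.div tendsto_const_nhds t0 hne (a := 1)) (by
    filter_upwards [hmem] with ε h
    rw [Pi.div_apply, one_div, Complex.inv_re, hre]
    exact div_nonneg h.le (Complex.normSq_nonneg _))
  have t3 : Filter.Tendsto (fun ε : ℝ => 1 / ((ε : ℂ) - n * Complex.I) ^ (1 / 2 : ℂ))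
      (nhdsWithin 0 (Set.Ioi 0)) (nhds (1 / (-(n * Complex.I)) ^ (1 / 2 : ℂ))) := by
    apply Filter.Tendsto.div tendsto_const_nhds
    · apply t0.cpow tendsto_const_nhds
      rw [Complex.mem_slitPlane_iff]
      right
      simp [hn.ne']
    · rw [Complex.cpow_ne_zero_iff]
      exact Or.inl hne
  rw [hinv]
  refine tendsto_nhds_unique (t1.congr' ?_) (t3.mul t2)
  filter_upwards [hmem] with ε h
  exact JJ_funct _ (by rw [hre]; exact h)

theorem const_val (n : ℝ) (hn : 0 < n) :
    1 / (-(n * Complex.I)) ^ (1 / 2 : ℂ) = ((1 / √(2 * n) : ℝ) : ℂ) * (1 + Complex.I) := by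
  have h : (-(n * Complex.I)) ^ (1 / 2 : ℂ) = ((√n : ℝ) : ℂ) * ((√2 / 2 : ℝ) * (1 - Complex.I)) := by
    rw [show (-(n * Complex.I)) = (n : ℂ) * (-Complex.I) by ring,
      Complex.cpow_def_of_ne_zero (by simp [hn.ne']), Complex.log_ofReal_mul hn (by simp),
      Complex.log_neg_I, show ((Real.log n : ℝ) + -(π / 2) * Complex.I) * (1 / 2 : ℂ) =
        ((Real.log n / 2 : ℝ) : ℂ) + ((-(π / 4) : ℝ) : ℂ) * Complex.I by push_cast; ring,
      Complex.exp_add, Complex.exp_mul_I, ← Complex.ofReal_exp, ← Complex.ofReal_cos,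
      ← Complex.ofReal_sin, Real.cos_neg, Real.sin_neg, Real.cos_pi_div_four,
      Real.sin_pi_div_four, ← Real.log_sqrt hn.le, Real.exp_log (Real.sqrt_pos.2 hn)]
    push_cast
    ring
  rw [h, Real.sqrt_mul (by norm_num)]
  have h2 : ((√2 : ℝ) : ℂ) ^ 2 = 2 := by
    exact_mod_cast Real.sq_sqrt (show (0:ℝ) ≤ 2 by norm_num)
  have h2n : ((√2 : ℝ) : ℂ) ≠ 0 := by simp
  have hnn : ((√n : ℝ) : ℂ) ≠ 0 := by exact_mod_cast (Real.sqrt_pos.2 hn).ne'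
  have hI : (1 - Complex.I) ≠ 0 := by
    intro h; have := congrArg Complex.re h; simp at this
  push_cast
  field_simp
  linear_combination Complex.I_sq

theorem JJ_re (a : ℝ) : (JJ (-(a * Complex.I))).re = 2 * Phi1 a ∧
    (JJ (-(a * Complex.I))).im = 2 * Psi1 a := by
  have hint := JJ_integrable (-(a * Complex.I)) (by simp)
  have e : ∀ x : ℝ, Complex.exp (-π * (-(a * Complex.I)) * x ^ 2) * ((1 / Real.cosh (π * x) : ℝ) : ℂ)
     = ((Real.cos (π * a * x ^ 2) / Real.cosh (π * x) : ℝ) : ℂ) +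
       ((Real.sin (π * a * x ^ 2) / Real.cosh (π * x) : ℝ) : ℂ) * Complex.I := by
    intro x
    rw [show (-π * (-(a * Complex.I)) * x ^ 2 : ℂ) = ((π * a * x ^ 2 : ℝ) : ℂ) * Complex.I by
      push_cast; ring, Complex.exp_mul_I, ← Complex.ofReal_cos, ← Complex.ofReal_sin]
    push_cast
    ring
  constructor
  · have h1 := integral_re hint
    simp only [RCLike.re_to_complex] at h1
    rw [JJ, ← h1, Phi1, ← integral_comp_abs (f := fun x => Real.cos (π * a * x ^ 2) / Real.cosh (π * x))]
    congr 1
    ext x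
    have : Real.cosh (π * |x|) = Real.cosh (π * x) := by
      rw [← Real.cosh_abs (π * x), abs_mul, abs_of_pos Real.pi_pos]
    rw [e, sq_abs, this, Complex.add_re, Complex.re_ofReal_mul, Complex.ofReal_re]
    simp
  · have h1 := integral_im hint
    simp only [RCLike.im_to_complex] at h1
    rw [JJ, ← h1, Psi1, ← integral_comp_abs (f := fun x => Real.sin (π * a * x ^ 2) / Real.cosh (π * x))]
    congr 1
    ext x
    have : Real.cosh (π * |x|) = Real.cosh (π * x) := by
      rw [← Real.cosh_abs (π * x), abs_mul, abs_of_pos Real.pi_pos]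
    rw [e, sq_abs, this, Complex.add_im, Complex.im_ofReal_mul, Complex.ofReal_im]
    simp

theorem stmt1 (n : ℝ) (hn : 0 < n) :
    Psi1 n = Real.sqrt (2 / n) * Phi1 (1 / n) - Phi1 n := by
  have h := JJ_funct_I n hn
  rw [const_val n hn] at h
  have h1 := JJ_re n
  have h2 := JJ_re (-(1 / n))
  rw [show (-(((-(1 / n) : ℝ) : ℂ) * Complex.I)) = ((1 / n : ℝ) : ℂ) * Complex.I by
    push_cast; ring] at h2
  have hP : Phi1 (-(1 / n)) = Phi1 (1 / n) := by
    unfold Phi1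
    congr 1
    ext x
    rw [← Real.cos_neg]
    congr 2
    ring
  rw [hP] at h2
  have hre := congrArg Complex.re h
  have him := congrArg Complex.im h
  rw [mul_assoc, Complex.re_ofReal_mul, Complex.mul_re, h1.1, h2.1, h2.2] at hre
  rw [mul_assoc, Complex.im_ofReal_mul, Complex.mul_im, h1.2, h2.1, h2.2] at him
  simp only [Complex.add_re, Complex.add_im, Complex.one_re, Complex.one_im, Complex.I_re,
    Complex.I_im] at hre him
  have hs : √(2 / n) = 2 * (1 / √(2 * n)) := by
    rw [Real.sqrt_div (by norm_num), Real.sqrt_mul (by norm_num)]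
    have := Real.sqrt_pos.2 hn
    have h2 := Real.sq_sqrt (show (0:ℝ) ≤ 2 by norm_num)
    field_simp
    linarith
  rw [hs]
  linarith
end

section
/- For every real number n > 0, the identity Φ₃(n) = (1/n)·√(2/n)·Ψ₃(1/n) − Ψ₃(n) holds, where Φ₃(a) = ∫₀^∞ cos(π a x)/(exp(2π√x) − 1) dx and Ψ₃(a) = 1/(2π a) + ∫₀^∞ sin(π a x)/(exp(2π√x) − 1) dx. -/
open Real MeasureTheory

open Real MeasureTheory

noncomputable def Phi3 (a : ℝ) : ℝ :=
  ∫ x in Set.Ioi (0:ℝ), Real.cos (π * a * x) / (Real.exp (2 * π * Real.sqrt x) - 1)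

noncomputable def Psi3 (a : ℝ) : ℝ :=
  1 / (2 * π * a) + ∫ x in Set.Ioi (0:ℝ), Real.sin (π * a * x) / (Real.exp (2 * π * Real.sqrt x) - 1)


/-- geometric expansion -/
lemma aux_geom {t : ℝ} (ht : 0 < t) :
    HasSum (fun k : ℕ => Real.exp (-(2 * π * (k + 1)) * t)) (1 / (Real.exp (2 * π * t) - 1)) := by
  have h1 : Real.exp (-(2 * π * t)) < 1 := by
    rw [Real.exp_lt_one_iff]; have := pi_pos; have := mul_pos this ht; linarith
  have h := (hasSum_geometric_of_lt_one (Real.exp_pos _).le h1).mul_left (Real.exp (-(2 * π * t)))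
  have e1 : (fun k : ℕ => Real.exp (-(2 * π * (k + 1)) * t)) =
      fun k : ℕ => Real.exp (-(2 * π * t)) * Real.exp (-(2 * π * t)) ^ k := by
    ext k
    rw [← Real.exp_nat_mul, ← Real.exp_add]; congr 1; ring
  rw [e1]
  convert! h using 1
  · clear e1 h
    rw [Real.exp_neg] at *
    have h2 : 1 < Real.exp (2 * π * t) := by
      rw [Real.one_lt_exp_iff]; positivity
    have h3 : Real.exp (2 * π * t) - 1 ≠ 0 := by linarith
    have h4 : 1 - (Real.exp (2 * π * t))⁻¹ ≠ 0 := by linarith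
    field_simp

lemma aux_bound {t : ℝ} (ht : 0 < t) :
    t / (Real.exp (2 * π * t) - 1) ≤ Real.exp (-π * t) := by
  have h0 : 0 < π * t := by positivity
  have h1 : π * t + 1 ≤ Real.exp (π * t) := Real.add_one_le_exp _
  have h2 : Real.exp (2 * π * t) = Real.exp (π * t) * Real.exp (π * t) := by
    rw [← Real.exp_add]; congr 1; ring
  have h3 : Real.exp (-π * t) * Real.exp (π * t) = 1 := by
    rw [← Real.exp_add]; simp
  have h4 := Real.exp_pos (-π * t)
  have h5 : Real.exp (-π * t) ≤ 1 := by
    rw [Real.exp_le_one_iff]; linarith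
  rw [div_le_iff₀ (by rw [h2]; nlinarith), h2]
  have : t ≤ π * t := by nlinarith [Real.pi_gt_three]
  nlinarith

lemma aux_pos {t : ℝ} (ht : 0 < t) : 0 < Real.exp (2 * π * t) - 1 := by
  have : 1 < Real.exp (2 * π * t) := by
    rw [Real.one_lt_exp_iff]; positivity
  linarith

lemma aux_int : IntegrableOn (fun t : ℝ => t / (Real.exp (2 * π * t) - 1)) (Set.Ioi 0) := by
  refine Integrable.mono' (g := fun t => Real.exp (-π * t)) ?_ ?_ ?_
  · exact integrableOn_exp_mul_Ioi (by simpa using pi_pos) 0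
  · exact Measurable.aestronglyMeasurable (by fun_prop)
  · refine (ae_restrict_iff' measurableSet_Ioi).2 (Filter.Eventually.of_forall fun t ht => ?_)
    rw [Real.norm_of_nonneg]
    · exact aux_bound ht
    · exact div_nonneg (le_of_lt ht) (aux_pos ht).le

lemma aux_sinexp (y : ℝ) {c : ℝ} (hc : 0 < c) :
    ∫ t in Set.Ioi (0:ℝ), Real.sin (2 * π * y * t) * Real.exp (-c * t)
      = 2 * π * y / (c ^ 2 + (2 * π * y) ^ 2) := by
  have hre : ((-c : ℂ) + 2 * π * y * Complex.I).re < 0 := by simp [hc]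
  have h := integral_exp_mul_complex_Ioi hre 0
  have h2 := integral_im (𝕜 := ℂ) (integrableOn_exp_mul_complex_Ioi hre 0)
  rw [h] at h2
  have e : ∀ t : ℝ, RCLike.im (Complex.exp (((-c : ℂ) + 2 * π * y * Complex.I) * t))
      = Real.sin (2 * π * y * t) * Real.exp (-c * t) := by
    intro t
    simp [Complex.exp_im]; ring
  simp only [e] at h2
  rw [h2]
  simp [Complex.div_im, Complex.normSq_apply]
  ring

lemma aux_mulexp {c : ℝ} (hc : 0 < c) :
    IntegrableOn (fun t : ℝ => t * Real.exp (-c * t)) (Set.Ioi 0) ∧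
    ∫ t in Set.Ioi (0:ℝ), t * Real.exp (-c * t) = 1 / c ^ 2 := by
  have h1 := integrableOn_rpow_mul_exp_neg_mul_rpow (p := 1) (s := 1) (b := c) (by norm_num) (by norm_num) hc
  have h2 := integral_rpow_mul_exp_neg_mul_Ioi (a := 2) (r := c) (by norm_num) hc
  simp only [Real.rpow_one] at h1
  refine ⟨h1, ?_⟩
  norm_num at h2
  simpa using h2

lemma aux_cot {y : ℝ} (hy : 0 < y) :
    HasSum (fun k : ℕ => 2 * π * y / ((2 * π * (k + 1)) ^ 2 + (2 * π * y) ^ 2))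
      (1 / 2 * (1 / (Real.exp (2 * π * y) - 1) - 1 / (2 * π * y) + 1 / 2)) := by
  have hz : (Complex.I * y : ℂ) ∈ Complex.integerComplement := by
    rintro ⟨n, hn⟩
    have := congrArg Complex.im hn
    simp at this
    linarith
  have hs := (summable_cotTerm hz).hasSum
  have hv := cot_series_rep' hz
  simp only [cotTerm] at hs
  rw [← hv, Complex.cot_pi_eq_exp_ratio] at hs
  have hs2 := hs.mul_left (Complex.I / (4 * π))
  rw [← Complex.hasSum_ofReal]
  have hE := aux_pos hy
  have hexp : Complex.exp (2 * π * Complex.I * (Complex.I * y)) = ((Real.exp (2 * π * y) : ℝ) : ℂ)⁻¹ := by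
    rw [← Complex.ofReal_inv, ← Real.exp_neg, Complex.ofReal_exp]
    congr 1
    push_cast
    linear_combination (2 * π * y : ℂ) * Complex.I_sq
  rw [hexp] at hs2
  have hpi : (π : ℂ) ≠ 0 := by exact_mod_cast pi_ne_zero
  have hyc : (y : ℂ) ≠ 0 := by exact_mod_cast hy.ne'
  convert! hs2 using 1
  · funext k
    have h1 : (Complex.I * y - (k + 1) : ℂ) ≠ 0 := by
      intro h; have := congrArg Complex.im h; simp at this; linarith
    have h2 : (Complex.I * y + (k + 1) : ℂ) ≠ 0 := by
      intro h; have := congrArg Complex.im h; simp at this; linarith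
    have h3 : ((2 * π * (k + 1)) ^ 2 + (2 * π * y) ^ 2 : ℂ) ≠ 0 := by
      have : (0:ℝ) < (2 * π * (k + 1)) ^ 2 + (2 * π * y) ^ 2 := by positivity
      exact_mod_cast this.ne'
    have h4 : ((2 * π * (k + 1)) ^ 2 + (2 * π * y) ^ 2 : ℂ) =
      -(4 * π ^ 2) * ((Complex.I * y - (k + 1)) * (Complex.I * y + (k + 1))) := by
      linear_combination (4 * π ^ 2 * y ^ 2 : ℂ) * Complex.I_sq
    push_cast
    rw [h4, one_div_add_one_div h1 h2]
    have h5 : (Complex.I * y - (k + 1) : ℂ) * (Complex.I * y + (k + 1)) ≠ 0 := mul_ne_zero h1 h2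
    have h6 : (Complex.I * y + (k + 1) + (Complex.I * y - (k + 1)) : ℂ) = 2 * Complex.I * y := by ring
    have h6' : (Complex.I * y - (k + 1) + (Complex.I * y + (k + 1)) : ℂ) = 2 * Complex.I * y := by ring
    first | rw [h6] | rw [h6']
    generalize (Complex.I * y - (k + 1) : ℂ) * (Complex.I * y + (k + 1)) = D at *
    field_simp
    linear_combination (-1 : ℂ) * Complex.I_sq
  · have h5 : ((Real.exp (2 * π * y) : ℝ) : ℂ) ≠ 0 := by exact_mod_cast (Real.exp_pos _).ne'
    have h6 : ((Real.exp (2 * π * y) : ℝ) : ℂ) - 1 ≠ 0 := by exact_mod_cast hE.ne'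
    generalize Real.exp (2 * π * y) = E' at *
    push_cast
    generalize (E' : ℂ) = E at *
    have h7 : 1 - E⁻¹ ≠ 0 := by
      intro h; apply h6; field_simp at h; simpa using h
    have h8 : (E⁻¹ + 1) / (Complex.I * (1 - E⁻¹)) = (E + 1) / (Complex.I * (E - 1)) := by
      field_simp
      ring
    rw [h8]
    field_simp
    ring

lemma aux_A {y : ℝ} (hy : 0 < y) :
    ∫ t in Set.Ioi (0:ℝ), Real.sin (2 * π * y * t) / (Real.exp (2 * π * t) - 1) =
      1 / 2 * (1 / (Real.exp (2 * π * y) - 1) - 1 / (2 * π * y) + 1 / 2) := by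
  have hb : ∀ (k : ℕ) (t : ℝ), t ∈ Set.Ioi (0:ℝ) →
      ‖Real.sin (2 * π * y * t) * Real.exp (-(2 * π * (k + 1)) * t)‖ ≤
        2 * π * y * (t * Real.exp (-(2 * π * (k + 1)) * t)) := by
    intro k t ht
    rw [norm_mul, Real.norm_of_nonneg (Real.exp_pos _).le, ← mul_assoc]
    gcongr
    refine (Real.abs_sin_le_abs).trans_eq (abs_of_nonneg ?_)
    have : 0 < t := ht
    positivity
  have hck : ∀ k : ℕ, 0 < 2 * π * ((k:ℝ) + 1) := fun k => by positivity
  have hI : ∀ k : ℕ, IntegrableOn (fun t : ℝ => Real.sin (2 * π * y * t) *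
      Real.exp (-(2 * π * (k + 1)) * t)) (Set.Ioi 0) := by
    intro k
    refine Integrable.mono' ((aux_mulexp (hck k)).1.const_mul (2 * π * y))
      (Continuous.aestronglyMeasurable (by fun_prop)) ?_
    exact (ae_restrict_iff' measurableSet_Ioi).2 (Filter.Eventually.of_forall (hb k))
  have hS : Summable fun k : ℕ => ∫ t in Set.Ioi (0:ℝ), ‖Real.sin (2 * π * y * t) *
      Real.exp (-(2 * π * (k + 1)) * t)‖ := by
    refine Summable.of_nonneg_of_le (f := fun k : ℕ => 2 * π * y / (2 * π) ^ 2 * (1 / ((k:ℝ) + 1) ^ 2))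
      (fun k => integral_nonneg fun _ => norm_nonneg _) (fun k => ?_) ?_
    · refine (setIntegral_mono_on (hI k).norm ((aux_mulexp (hck k)).1.const_mul (2 * π * y))
        measurableSet_Ioi (hb k)).trans_eq ?_
      rw [integral_const_mul, (aux_mulexp (hck k)).2]
      field_simp
    · apply Summable.mul_left
      have := (summable_nat_add_iff 1).2 (Real.summable_one_div_nat_pow.2 (by norm_num : 1 < 2))
      simpa using this
  have h := hasSum_integral_of_summable_integral_norm hI hS
  have e : ∀ k : ℕ, ∫ t in Set.Ioi (0:ℝ), Real.sin (2 * π * y * t) *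
      Real.exp (-(2 * π * (k + 1)) * t) = _ := fun k => aux_sinexp y (hck k)
  rw [funext e] at h
  rw [← h.unique (aux_cot hy)]
  refine setIntegral_congr_fun measurableSet_Ioi fun t ht => ?_
  rw [tsum_mul_left, (aux_geom ht).tsum_eq, mul_one_div]

lemma aux_B1 {s : ℂ} (hs : 0 < s.re) (t : ℝ) :
    ∫ y in Set.Ioi (0:ℝ), Complex.cos (2 * π * y * t) * Complex.exp (-(π * s) * (y:ℂ) ^ 2) =
      1 / 2 * (1 / s) ^ (1 / 2 : ℂ) * Complex.exp (-(π * t ^ 2 / s)) := by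
  have hs0 : s ≠ 0 := by rintro rfl; simp at hs
  have hb : 0 < ((π:ℂ) * s).re := by simp [pi_pos, hs]
  have hF := fourierIntegral_gaussian hb (2 * π * t)
  set f : ℝ → ℂ := fun y => Complex.exp (Complex.I * (2 * π * t) * y) * Complex.exp (-(π * s) * (y:ℂ) ^ 2) with hf
  have hint : Integrable f := by
    refine (integrable_cexp_quadratic hb (Complex.I * (2 * π * t)) 0).congr
      (Filter.Eventually.of_forall fun y => ?_)
    simp only [hf, ← Complex.exp_add]
    congr 1; ring
  have h1 : ∫ y in Set.Ioi (0:ℝ), f (-y) = ∫ y in Set.Iic (0:ℝ), f y := by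
    simpa using integral_comp_neg_Ioi 0 f
  have h2 : ∫ y in Set.Ioi (0:ℝ), Complex.cos (2 * π * y * t) * Complex.exp (-(π * s) * (y:ℂ) ^ 2)
    = ∫ y in Set.Ioi (0:ℝ), (1/2 : ℂ) * (f (-y) + f y) := by
    congr 1; ext y
    simp only [hf, Complex.cos]
    push_cast
    rw [neg_sq, ← add_mul, ← mul_assoc, add_comm]
    congr 1
    rw [div_eq_inv_mul, one_div]
    congr 3 <;> ring_nf
  rw [h2, integral_const_mul, integral_add hint.comp_neg.integrableOn hint.integrableOn, h1]
  rw [intervalIntegral.integral_Iic_add_Ioi hint.integrableOn hint.integrableOn, hF]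
  have hpi : (π : ℂ) ≠ 0 := by exact_mod_cast pi_ne_zero
  have e1 : (π : ℂ) / (π * s) = 1 / s := by field_simp
  have e2 : -(2 * π * t : ℂ) ^ 2 / (4 * (π * s)) = -(π * t ^ 2 / s) := by field_simp; ring
  rw [e1, e2, mul_assoc]

lemma aux_B {s : ℂ} (hs : 0 < s.re) (t : ℝ) :
    ∫ y in Set.Ioi (0:ℝ), ((Real.sin (2 * π * y * t) : ℝ) : ℂ) * (y * Complex.exp (-(π * s) * (y:ℂ) ^ 2)) =
      t / s * (1 / 2 * (1 / s) ^ (1 / 2 : ℂ) * Complex.exp (-(π * t ^ 2 / s))) := by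
  have hs0 : s ≠ 0 := by rintro rfl; simp at hs
  have hpi : (π : ℂ) ≠ 0 := by exact_mod_cast pi_ne_zero
  have hb : 0 < ((π:ℂ) * s).re := by simp [pi_pos, hs]
  have hi1 : Integrable (fun y : ℝ => ((Real.sin (2 * π * y * t) : ℝ) : ℂ) *
      (y * Complex.exp (-(π * s) * (y:ℂ) ^ 2))) := by
    refine (integrable_mul_cexp_neg_mul_sq hb).bdd_mul (c := 1)
      (Continuous.aestronglyMeasurable (by fun_prop)) (Filter.Eventually.of_forall fun y => ?_)
    rw [Complex.norm_real]; exact Real.abs_sin_le_one _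
  have hi2 : Integrable (fun y : ℝ => ((Real.cos (2 * π * y * t) : ℝ) : ℂ) *
      (Complex.exp (-(π * s) * (y:ℂ) ^ 2))) := by
    refine (integrable_cexp_neg_mul_sq hb).bdd_mul (c := 1)
      (Continuous.aestronglyMeasurable (by fun_prop)) (Filter.Eventually.of_forall fun y => ?_)
    rw [Complex.norm_real]; exact Real.abs_cos_le_one _
  have hd : ∀ y ∈ Set.Ici (0:ℝ), HasDerivAt
      (fun y : ℝ => ((Real.sin (2 * π * y * t) : ℝ) : ℂ) * Complex.exp (-(π * s) * (y:ℂ) ^ 2))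
      ((2 * π * t) * (((Real.cos (2 * π * y * t) : ℝ) : ℂ) * (Complex.exp (-(π * s) * (y:ℂ) ^ 2)))
        - (2 * π * s) * (((Real.sin (2 * π * y * t) : ℝ) : ℂ) *
      (y * Complex.exp (-(π * s) * (y:ℂ) ^ 2)))) y := by
    intro y _
    have h1 : HasDerivAt (fun y : ℝ => Real.sin (2 * π * y * t)) (Real.cos (2 * π * y * t) * (2 * π * t)) y := by
      have : HasDerivAt (fun y : ℝ => 2 * π * y * t) (2 * π * t) y := by
        simpa using ((hasDerivAt_id y).const_mul (2 * π)).mul_const t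
      exact this.sin
    have h2 : HasDerivAt (fun y : ℝ => Complex.exp (-(π * s) * (y:ℂ) ^ 2))
        (Complex.exp (-(π * s) * (y:ℂ) ^ 2) * (-(π * s) * (2 * y))) y := by
      have : HasDerivAt (fun z : ℂ => -(π * s) * z ^ 2) (-(π * s) * (2 * y)) (y:ℂ) := by
        simpa using ((hasDerivAt_id (y:ℂ)).pow 2).const_mul (-(π * s))
      exact this.cexp.comp_ofReal
    convert! h1.ofReal_comp.mul h2 using 1
    push_cast
    ring
  have hlim : Filter.Tendsto (fun y : ℝ => ((Real.sin (2 * π * y * t) : ℝ) : ℂ) *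
      Complex.exp (-(π * s) * (y:ℂ) ^ 2)) Filter.atTop (nhds 0) := by
    refine squeeze_zero_norm' (a := fun y : ℝ => Real.exp (-(π * s.re) * y)) ?_ ?_
    · filter_upwards [Filter.eventually_ge_atTop 1] with y hy
      rw [norm_mul, Complex.norm_real, norm_cexp_neg_mul_sq]
      refine (mul_le_of_le_one_left (Real.exp_pos _).le (Real.abs_sin_le_one _)).trans ?_
      rw [Real.exp_le_exp]
      have : y ≤ y ^ 2 := by nlinarith
      simp at hb ⊢
      nlinarith
    · refine Real.tendsto_exp_atBot.comp ?_
      have : 0 < π * s.re := by positivity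
      exact Filter.tendsto_id.const_mul_atTop_of_neg (by linarith)
  have key := integral_Ioi_of_hasDerivAt_of_tendsto' hd
    ((hi2.integrableOn.const_mul _).sub (hi1.integrableOn.const_mul _)) hlim
  rw [integral_sub (hi2.integrableOn.const_mul _) (hi1.integrableOn.const_mul _),
    integral_const_mul, integral_const_mul] at key
  have hB := aux_B1 hs t
  rw [← hB]
  simp only [Complex.ofReal_zero, mul_zero, zero_mul, Real.sin_zero, sub_zero, Complex.ofReal_cos,
    Complex.ofReal_mul, Complex.ofReal_ofNat] at key
  rw [div_mul_eq_mul_div, eq_div_iff hs0]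
  have h2 : (2 * π : ℂ) ≠ 0 := by simp [hpi]
  apply mul_left_cancel₀ h2
  linear_combination -key

noncomputable def FF (s : ℂ) : ℂ :=
  ∫ y in Set.Ioi (0:ℝ), ((2 * (y / (Real.exp (2 * π * y) - 1)) : ℝ) : ℂ) * Complex.exp (-(π * s) * (y:ℂ) ^ 2)

lemma aux_fubini {s : ℂ} (hs : 0 < s.re) :
    Integrable (Function.uncurry fun (y t : ℝ) => ((Real.sin (2 * π * y * t) / (Real.exp (2 * π * t) - 1) : ℝ) : ℂ) *
      (y * Complex.exp (-(π * s) * (y:ℂ) ^ 2)))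
      ((volume.restrict (Set.Ioi (0:ℝ))).prod (volume.restrict (Set.Ioi (0:ℝ)))) := by
  have hb : 0 < π * s.re := by positivity
  have h1 : IntegrableOn (fun y : ℝ => 2 * π * (y ^ (2:ℝ) * Real.exp (-(π * s.re) * y ^ 2))) (Set.Ioi 0) :=
    (integrableOn_rpow_mul_exp_neg_mul_sq hb (by norm_num)).const_mul _
  refine Integrable.mono' (Integrable.mul_prod h1 aux_int) ?_ ?_
  · apply Measurable.aestronglyMeasurable
    unfold Function.uncurry
    fun_prop
  · rw [Measure.prod_restrict]
    refine (ae_restrict_iff' (measurableSet_Ioi.prod measurableSet_Ioi)).2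
      (Filter.Eventually.of_forall ?_)
    rintro ⟨y, t⟩ ⟨hy, ht⟩
    have hy : 0 < y := hy
    have ht : 0 < t := ht
    have hE := aux_pos ht
    simp only [Function.uncurry]
    rw [norm_mul, norm_mul, norm_cexp_neg_mul_sq, Complex.norm_real, Complex.norm_real,
      Real.norm_of_nonneg hy.le, norm_div, Real.norm_of_nonneg hE.le]
    have h3 : ‖Real.sin (2 * π * y * t)‖ ≤ 2 * π * y * t :=
      (Real.abs_sin_le_abs).trans_eq (abs_of_nonneg (by positivity))
    have h4 : ((π : ℂ) * s).re = π * s.re := by simp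
    rw [h4, Real.rpow_two]
    calc _ ≤ (2 * π * y * t) / (Real.exp (2 * π * t) - 1) * (y * Real.exp (-(π * s.re) * y ^ 2)) := by
          gcongr
      _ = _ := by ring

lemma aux_FE {s : ℂ} (hs : 0 < s.re) :
    FF s = (1 / s) ^ (1 / 2 : ℂ) / (2 * π) - 1 / (2 * π * s) + (1 / s) ^ (1 / 2 : ℂ) / s * FF (1 / s) := by
  have hs0 : s ≠ 0 := by rintro rfl; simp at hs
  have hpi : (π : ℂ) ≠ 0 := by exact_mod_cast pi_ne_zero
  have hb : 0 < ((π:ℂ) * s).re := by simp [pi_pos, hs]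
  have hf := aux_fubini hs
  have hi3 := hf.integral_prod_left
  have hi1 := (integrable_cexp_neg_mul_sq hb).integrableOn (s := Set.Ioi (0:ℝ))
  have hi2 := (integrable_mul_cexp_neg_mul_sq hb).integrableOn (s := Set.Ioi (0:ℝ))
  have hsw := integral_integral_swap hf
  simp only [Function.uncurry] at hi3
  have hi12 : IntegrableOn (fun y : ℝ => (1 / π : ℂ) * Complex.exp (-(π * s) * (y:ℂ) ^ 2)
      - y * Complex.exp (-(π * s) * (y:ℂ) ^ 2)) (Set.Ioi 0) := (hi1.const_mul _).sub hi2
  have e1 : FF s = ∫ y in Set.Ioi (0:ℝ), ((1 / π : ℂ) * Complex.exp (-(π * s) * (y:ℂ) ^ 2)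
      - y * Complex.exp (-(π * s) * (y:ℂ) ^ 2)) +
      4 * ∫ t in Set.Ioi (0:ℝ), ((Real.sin (2 * π * y * t) / (Real.exp (2 * π * t) - 1) : ℝ) : ℂ) *
      (y * Complex.exp (-(π * s) * (y:ℂ) ^ 2)) := by
    refine setIntegral_congr_fun measurableSet_Ioi fun y hy => ?_
    have hy : 0 < y := hy
    have hyc : (y : ℂ) ≠ 0 := by exact_mod_cast hy.ne'
    have hE : ((Real.exp (2 * π * y) : ℝ) : ℂ) - 1 ≠ 0 := by exact_mod_cast (aux_pos hy).ne'
    beta_reduce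
    rw [integral_mul_const, integral_complex_ofReal, aux_A hy]
    generalize Real.exp (2 * π * y) = E at *
    push_cast
    field_simp
    ring
  have e2 : ∫ t in Set.Ioi (0:ℝ), ∫ y in Set.Ioi (0:ℝ),
      ((Real.sin (2 * π * y * t) / (Real.exp (2 * π * t) - 1) : ℝ) : ℂ) *
      (y * Complex.exp (-(π * s) * (y:ℂ) ^ 2)) = (1 / s) ^ (1 / 2 : ℂ) / s / 4 * FF (1 / s) := by
    rw [FF, ← integral_const_mul]
    refine setIntegral_congr_fun measurableSet_Ioi fun t ht => ?_
    have ht : 0 < t := ht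
    have hE : ((Real.exp (2 * π * t) : ℝ) : ℂ) - 1 ≠ 0 := by exact_mod_cast (aux_pos ht).ne'
    beta_reduce
    have : ∀ y : ℝ, ((Real.sin (2 * π * y * t) / (Real.exp (2 * π * t) - 1) : ℝ) : ℂ) *
      (y * Complex.exp (-(π * s) * (y:ℂ) ^ 2)) = (1 / (((Real.exp (2 * π * t) : ℝ) : ℂ) - 1)) *
        (((Real.sin (2 * π * y * t) : ℝ) : ℂ) * (y * Complex.exp (-(π * s) * (y:ℂ) ^ 2))) := by
      intro y
      rw [Complex.ofReal_div, Complex.ofReal_sub, Complex.ofReal_one]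
      ring
    simp_rw [this]
    rw [integral_const_mul, aux_B hs]
    have e3 : -((π:ℂ) * (1 / s)) * (t:ℂ) ^ 2 = -(π * t ^ 2 / s) := by ring
    rw [e3, Complex.ofReal_mul, Complex.ofReal_div, Complex.ofReal_sub, Complex.ofReal_one]
    push_cast
    ring
  rw [e1, integral_add hi12 (hi3.const_mul 4),
    integral_sub (hi1.const_mul _) hi2, integral_const_mul, integral_const_mul, hsw, e2,
    integral_gaussian_complex_Ioi hb, integral_mul_cexp_neg_mul_sq hb]
  have e4 : (π : ℂ) / (π * s) = 1 / s := by field_simp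
  rw [e4]
  field_simp

lemma aux_lim {z : ℂ} {u : ℝ → ℂ} (hu : Filter.Tendsto u (nhdsWithin 0 (Set.Ioi 0)) (nhds z))
    (hp : ∀ᶠ e in nhdsWithin 0 (Set.Ioi 0), 0 ≤ (u e).re) :
    Filter.Tendsto (fun e => FF (u e)) (nhdsWithin 0 (Set.Ioi 0)) (nhds (FF z)) := by
  unfold FF
  refine tendsto_integral_filter_of_dominated_convergence
    (fun y => 2 * (y / (Real.exp (2 * π * y) - 1))) ?_ ?_ (aux_int.const_mul 2) ?_
  · refine Filter.Eventually.of_forall fun e => Measurable.aestronglyMeasurable ?_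
    fun_prop
  · filter_upwards [hp] with e he
    refine (ae_restrict_iff' measurableSet_Ioi).2 (Filter.Eventually.of_forall fun y hy => ?_)
    have hy : 0 < y := hy
    have h0 : 0 ≤ 2 * (y / (Real.exp (2 * π * y) - 1)) := by
      have := aux_pos hy
      positivity
    rw [norm_mul, Complex.norm_real, Real.norm_of_nonneg h0, norm_cexp_neg_mul_sq]
    refine mul_le_of_le_one_right h0 (Real.exp_le_one_iff.2 ?_)
    have : 0 ≤ π * (u e).re := by positivity
    simp
    positivity
  · refine Filter.Eventually.of_forall fun y => ?_
    refine Filter.Tendsto.const_mul _ (Filter.Tendsto.cexp ?_)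
    exact ((hu.const_mul _).neg).mul_const _

lemma aux_subst (g : ℝ → ℝ) :
    ∫ x in Set.Ioi (0:ℝ), g x / (Real.exp (2 * π * Real.sqrt x) - 1) =
    ∫ y in Set.Ioi (0:ℝ), 2 * (y / (Real.exp (2 * π * y) - 1)) * g (y ^ 2) := by
  rw [← integral_comp_rpow_Ioi_of_pos (p := 2) (by norm_num)]
  refine setIntegral_congr_fun measurableSet_Ioi fun y hy => ?_
  have hy : 0 < y := hy
  have h : (2:ℝ) - 1 = 1 := by norm_num
  simp only [smul_eq_mul, h, Real.rpow_one, Real.rpow_two, Real.sqrt_sq hy.le]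
  ring

lemma aux_FF_I (a : ℝ) :
    FF (-(Complex.I * a)) =
      ((∫ x in Set.Ioi (0:ℝ), Real.cos (π * a * x) / (Real.exp (2 * π * Real.sqrt x) - 1) : ℝ) : ℂ) +
      Complex.I * ((∫ x in Set.Ioi (0:ℝ), Real.sin (π * a * x) / (Real.exp (2 * π * Real.sqrt x) - 1) : ℝ) : ℂ) := by
  rw [aux_subst (fun x => Real.cos (π * a * x)), aux_subst (fun x => Real.sin (π * a * x)),
    ← integral_complex_ofReal, ← integral_complex_ofReal, ← integral_const_mul]
  have i1 : IntegrableOn (fun y : ℝ => 2 * (y / (Real.exp (2 * π * y) - 1)) * Real.cos (π * a * y ^ 2)) (Set.Ioi 0) :=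
    (aux_int.const_mul 2).mul_bdd (c := 1) (Continuous.aestronglyMeasurable (by fun_prop))
      (Filter.Eventually.of_forall fun y => Real.abs_cos_le_one _)
  have i2 : IntegrableOn (fun y : ℝ => 2 * (y / (Real.exp (2 * π * y) - 1)) * Real.sin (π * a * y ^ 2)) (Set.Ioi 0) :=
    (aux_int.const_mul 2).mul_bdd (c := 1) (Continuous.aestronglyMeasurable (by fun_prop))
      (Filter.Eventually.of_forall fun y => Real.abs_sin_le_one _)
  rw [← integral_add i1.ofReal (i2.ofReal.const_mul _), FF]
  congr 1
  ext y
  have : -((π:ℂ) * -(Complex.I * a)) * (y:ℂ) ^ 2 = ((π * a * y ^ 2 : ℝ) : ℂ) * Complex.I := by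
    push_cast; ring
  rw [this, Complex.exp_mul_I, ← Complex.ofReal_cos, ← Complex.ofReal_sin]
  push_cast
  ring

lemma aux_FE_I {n : ℝ} (hn : 0 < n) :
    FF (-(Complex.I * n)) = (Complex.I / n) ^ (1 / 2 : ℂ) / (2 * π) - Complex.I / n / (2 * π) +
      (Complex.I / n) ^ (1 / 2 : ℂ) * (Complex.I / n) * FF (Complex.I / n) := by
  have hnc : (n : ℂ) ≠ 0 := by exact_mod_cast hn.ne'
  have hu : Filter.Tendsto (fun e : ℝ => (e : ℂ) + -(Complex.I * n)) (nhdsWithin 0 (Set.Ioi 0))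
      (nhds (-(Complex.I * n))) := by
    have : Continuous (fun e : ℝ => (e : ℂ) + -(Complex.I * n)) := by fun_prop
    have := this.tendsto 0
    simp only [Complex.ofReal_zero, zero_add] at this
    exact this.mono_left nhdsWithin_le_nhds
  have hI : 1 / (-(Complex.I * n)) = Complex.I / n := by
    field_simp; simp
  have hu' : Filter.Tendsto (fun e : ℝ => 1 / ((e : ℂ) + -(Complex.I * n))) (nhdsWithin 0 (Set.Ioi 0))
      (nhds (Complex.I / n)) := by
    rw [← hI]
    simpa only [one_div] using hu.inv₀ (by simp [hnc])
  have hpos : ∀ᶠ e : ℝ in nhdsWithin 0 (Set.Ioi 0), 0 < ((e : ℂ) + -(Complex.I * n)).re := by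
    filter_upwards [self_mem_nhdsWithin] with e he
    simpa using he
  have hpos' : ∀ᶠ e : ℝ in nhdsWithin 0 (Set.Ioi 0), 0 ≤ (1 / ((e : ℂ) + -(Complex.I * n))).re := by
    filter_upwards [hpos] with e he
    rw [one_div, Complex.inv_re]
    exact div_nonneg he.le (Complex.normSq_nonneg _)
  have hw := hu'.cpow (tendsto_const_nhds (x := (1 / 2 : ℂ))) (by
    right
    simp [Complex.div_im, hn.ne'])
  have L := aux_lim hu (hpos.mono fun _ h => h.le)
  have R := ((hw.div_const (2 * π : ℂ)).sub (hu'.div_const (2 * π : ℂ))).add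
    ((hw.mul hu').mul (aux_lim hu' hpos'))
  refine tendsto_nhds_unique (L.congr' ?_) R
  filter_upwards [hpos] with e he
  rw [aux_FE he]
  generalize (e : ℂ) + -(Complex.I * n) = z
  ring

lemma aux_root {n : ℝ} (hn : 0 < n) :
    (Complex.I / n) ^ (1 / 2 : ℂ) = (1 + Complex.I) * ((Real.sqrt (2 / n) / 2 : ℝ) : ℂ) := by
  have h1 : Complex.I / n = ((1 + Complex.I) * ((Real.sqrt (2 / n) / 2 : ℝ) : ℂ)) ^ 2 := by
    have h2 : ((Real.sqrt (2 / n) : ℝ) : ℂ) ^ 2 = 2 / n := by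
      rw [← Complex.ofReal_pow, Real.sq_sqrt (by positivity)]
      push_cast; rfl
    push_cast
    rw [mul_pow, div_pow, h2, add_sq, Complex.I_sq]
    ring
  have h3 : 0 < Real.sqrt (2 / n) := Real.sqrt_pos.2 (by positivity)
  have hre : 0 < ((1 + Complex.I) * ((Real.sqrt (2 / n) / 2 : ℝ) : ℂ)).re := by
    simp [hn]
  rw [h1, one_div]
  have := Complex.pow_cpow_nat_inv (x := (1 + Complex.I) * ((Real.sqrt (2 / n) / 2 : ℝ) : ℂ)) (n := 2) (by norm_num)
    (by have := Complex.abs_arg_lt_pi_div_two_iff.2 (Or.inl hre); rw [Nat.cast_ofNat]; linarith [(abs_lt.1 this).1])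
    (by have := Complex.abs_arg_lt_pi_div_two_iff.2 (Or.inl hre); rw [Nat.cast_ofNat]; linarith [(abs_lt.1 this).2])
  simpa using this

theorem stmt4 (n : ℝ) (hn : 0 < n) :
    Phi3 n = (1 / n) * Real.sqrt (2 / n) * Psi3 (1 / n) - Psi3 n := by
  have h := aux_FE_I hn
  have e : Complex.I / n = -(Complex.I * ((-(1 / n) : ℝ) : ℂ)) := by push_cast; ring
  rw [aux_root hn] at h
  rw [show FF (Complex.I / n) = _ by rw [e, aux_FF_I], aux_FF_I] at h
  have hc : ∀ x, Real.cos (π * -(1 / n) * x) = Real.cos (π * (1 / n) * x) := fun x => by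
    rw [← Real.cos_neg]; congr 1; ring
  have hsn : ∀ x, Real.sin (π * -(1 / n) * x) = -Real.sin (π * (1 / n) * x) := fun x => by
    rw [← Real.sin_neg]; congr 1; ring
  simp only [hc, hsn, neg_div, integral_neg] at h
  unfold Phi3 Psi3
  generalize (∫ x in Set.Ioi (0:ℝ), Real.cos (π * n * x) / (Real.exp (2 * π * Real.sqrt x) - 1)) = C1 at *
  generalize (∫ x in Set.Ioi (0:ℝ), Real.sin (π * n * x) / (Real.exp (2 * π * Real.sqrt x) - 1)) = S1 at *
  generalize (∫ x in Set.Ioi (0:ℝ), Real.cos (π * (1 / n) * x) / (Real.exp (2 * π * Real.sqrt x) - 1)) = C2 at *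
  generalize (∫ x in Set.Ioi (0:ℝ), Real.sin (π * (1 / n) * x) / (Real.exp (2 * π * Real.sqrt x) - 1)) = S2 at *
  generalize Real.sqrt (2 / n) = q at *
  have h' : (C1 : ℂ) + Complex.I * S1 = ((q / 2 / (2 * π) - 1 / n * (q / 2) * (C2 - S2) : ℝ) : ℂ) +
      Complex.I * ((q / 2 / (2 * π) - 1 / n / (2 * π) + 1 / n * (q / 2) * (C2 + S2) : ℝ) : ℂ) := by
    rw [h]
    push_cast
    have := Complex.I_sq
    have h3 : Complex.I ^ 3 = -Complex.I := Complex.I_pow_three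
    ring_nf
    simp only [Complex.I_sq, h3]
    ring
  have hr := congrArg Complex.re h'
  have hi := congrArg Complex.im h'
  simp only [Complex.add_re, Complex.add_im, Complex.mul_re, Complex.mul_im, Complex.ofReal_re,
    Complex.ofReal_im, Complex.I_re, Complex.I_im] at hr hi
  have hr : C1 = q / 2 / (2 * π) - 1 / n * (q / 2) * (C2 - S2) := by linarith
  have hi : S1 = q / 2 / (2 * π) - 1 / n / (2 * π) + 1 / n * (q / 2) * (C2 + S2) := by linarith
  rw [hr, hi]
  have := pi_pos
  field_simp
  ring
end

section
/- For every real number n > 0, the identity Ψ₃(n) = (1/n)·√(2/n)·Φ₃(1/n) + Φ₃(n) holds, where Φ₃(a) = ∫₀^∞ cos(π a x)/(exp(2π√x) − 1) dx and Ψ₃(a) = 1/(2π a) + ∫₀^∞ sin(π a x)/(exp(2π√x) − 1) dx. -/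
open Real MeasureTheory

noncomputable def hh (t : ℝ) : ℝ := 1 / (Real.exp (2 * π * t) - 1)

lemma hh_pos {t : ℝ} (ht : 0 < t) : 0 < hh t := by
  unfold hh
  have : 1 < Real.exp (2 * π * t) := by
    apply Real.one_lt_exp_iff.2; positivity
  apply one_div_pos.2; linarith

lemma hh_meas : Measurable hh := by
  unfold hh; fun_prop

lemma hh_bound {t : ℝ} (ht : 0 < t) : t * hh t ≤ Real.exp (-π * t) := by
  have h1 : π * t ≤ Real.sinh (π * t) := Real.self_le_sinh_iff.2 (by positivity)
  have h2 : Real.exp (2 * π * t) - 1 = 2 * Real.sinh (π * t) * Real.exp (π * t) := by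
    rw [Real.sinh_eq]
    have e1 : Real.exp (2 * π * t) = Real.exp (π * t) * Real.exp (π * t) := by
      rw [← Real.exp_add]; ring_nf
    have e2 : Real.exp (-(π * t)) * Real.exp (π * t) = 1 := by
      rw [← Real.exp_add]; simp
    rw [e1]; linear_combination e2
  unfold hh
  rw [h2, neg_mul, Real.exp_neg]
  have hE := Real.exp_pos (π * t)
  have hpt : 0 < π * t := by positivity
  rw [mul_one_div, div_le_iff₀ (by positivity)]
  have : (Real.exp (π * t))⁻¹ * (2 * Real.sinh (π * t) * Real.exp (π * t)) = 2 * Real.sinh (π * t) := by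
    field_simp
  rw [this]
  have : t ≤ π * t := by nlinarith [Real.pi_gt_three]
  linarith

lemma hh_int : IntegrableOn (fun t => t * hh t) (Set.Ioi 0) := by
  refine Integrable.mono' (exp_neg_integrableOn_Ioi 0 Real.pi_pos) ?_ ?_
  · exact (measurable_id.mul hh_meas).aestronglyMeasurable
  · filter_upwards [ae_restrict_mem measurableSet_Ioi] with t ht
    have ht : 0 < t := ht
    rw [Real.norm_of_nonneg (mul_pos ht (hh_pos ht)).le]
    exact hh_bound ht

lemma hh_hasSum {t : ℝ} (ht : 0 < t) :
    HasSum (fun k : ℕ => Real.exp (-(2 * π * (k + 1)) * t)) (hh t) := by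
  have hlt : Real.exp (-(2 * π * t)) < 1 := by
    apply Real.exp_lt_one_iff.2; have : 0 < 2 * π * t := by positivity
    linarith
  have h := (hasSum_geometric_of_lt_one (Real.exp_pos _).le hlt).mul_left (Real.exp (-(2 * π * t)))
  convert! h using 1
  · funext k
    rw [← Real.exp_nat_mul, ← Real.exp_add]; congr 1; ring
  · unfold hh
    have h1 : Real.exp (2 * π * t) * Real.exp (-(2 * π * t)) = 1 := by
      rw [← Real.exp_add]; simp
    have : 1 < Real.exp (2 * π * t) := by
      apply Real.one_lt_exp_iff.2; positivity
    rw [← div_eq_mul_inv, div_eq_div_iff (by linarith) (by linarith)]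
    linear_combination -h1

lemma int_sin_exp (t c : ℝ) (hc : 0 < c) :
    IntegrableOn (fun y => Real.sin (2 * π * t * y) * Real.exp (-c * y)) (Set.Ioi 0) ∧
    ∫ y in Set.Ioi (0:ℝ), Real.sin (2 * π * t * y) * Real.exp (-c * y)
      = 2 * π * t / (c ^ 2 + (2 * π * t) ^ 2) := by
  set a : ℂ := ⟨-c, 2 * π * t⟩ with ha
  have hre : a.re < 0 := by simp [ha, hc]
  have hi := integrableOn_exp_mul_complex_Ioi hre 0
  have he := integral_exp_mul_complex_Ioi hre 0
  have hf : ∀ y : ℝ, (Complex.exp (a * y)).im = Real.sin (2 * π * t * y) * Real.exp (-c * y) := by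
    intro y
    rw [Complex.exp_im]
    simp [ha, mul_comm]
  constructor
  · have := hi.im
    simpa [IntegrableOn, hf] using this
  · have h2 := integral_im hi
    simp only [RCLike.im_to_complex, hf] at h2
    rw [h2]
    simp only [he]
    simp only [Complex.ofReal_zero, mul_zero, Complex.exp_zero, Complex.div_im, Complex.normSq_apply, ha]
    simp
    ring

lemma K_eq {t : ℝ} (ht : 0 < t) :
    ∫ y in Set.Ioi (0:ℝ), Real.sin (2 * π * t * y) * hh y
      = 1 / 4 + hh t / 2 - 1 / (4 * π * t) := by
  have key := hasSum_integral_of_summable_integral_norm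
    (μ := volume.restrict (Set.Ioi (0:ℝ)))
    (F := fun (k : ℕ) (y : ℝ) => Real.sin (2 * π * t * y) * Real.exp (-(2 * π * (k + 1)) * y))
    (fun k => (int_sin_exp t _ (by positivity)).1) ?_
  · have h1 : ∫ y in Set.Ioi (0:ℝ), Real.sin (2 * π * t * y) * hh y =
        ∫ y in Set.Ioi (0:ℝ), ∑' k : ℕ,
          Real.sin (2 * π * t * y) * Real.exp (-(2 * π * (k + 1)) * y) := by
      apply setIntegral_congr_fun measurableSet_Ioi
      intro y hy
      exact ((hh_hasSum hy).mul_left _).tsum_eq.symm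
    rw [h1]
    refine key.unique ?_
    have hz : (Complex.I * t : ℂ) ∈ Complex.integerComplement := by
      rw [Complex.mem_integerComplement_iff]
      rintro ⟨n, hn⟩
      have := congrArg Complex.im hn
      simp at this
      exact ht.ne this
    have hs := summable_cotTerm hz
    have hc := cot_series_rep' hz
    have hs2 := hs.hasSum
    have e0 : ∑' n, cotTerm (Complex.I * t) n = ∑' (n : ℕ), (1 / ((Complex.I * t) - (↑n + 1)) + 1 / ((Complex.I * t) + (↑n + 1))) := rfl
    rw [e0, ← hc, Complex.cot_pi_eq_exp_ratio] at hs2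
    have hs3 := (hs2.mul_left (Complex.I / (4 * π)))
    rw [← Complex.hasSum_ofReal]
    have htc : (t : ℂ) ≠ 0 := by exact_mod_cast ht.ne'
    have hpc : (π : ℂ) ≠ 0 := by exact_mod_cast Real.pi_ne_zero
    convert! hs3 using 1
    · funext k
      rw [(int_sin_exp t _ (by positivity)).2]
      unfold cotTerm
      have hk : ((k:ℂ)+1) ^ 2 + (t:ℂ)^2 ≠ 0 := by
        have : ((k:ℝ)+1) ^ 2 + (t:ℝ)^2 ≠ 0 := by positivity
        exact_mod_cast this
      have f : (Complex.I * t - (k + 1)) * (Complex.I * t + (k+1)) = - (((k:ℂ)+1) ^ 2 + (t:ℂ)^2) := by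
        linear_combination (t:ℂ)^2 * Complex.I_sq
      have n1 : (Complex.I * t - (k + 1)) ≠ 0 := by
        intro h; rw [h, zero_mul] at f; exact hk (by linear_combination f)
      have n2 : (Complex.I * t + (k + 1)) ≠ 0 := by
        intro h; rw [h, mul_zero] at f; exact hk (by linear_combination f)
      rw [div_add_div _ _ n1 n2, f]
      push_cast
      have : (2 * (π:ℂ) * (k+1))^2 + (2 * π * t)^2 = 4 * π^2 * (((k:ℂ)+1) ^ 2 + (t:ℂ)^2) := by ring
      rw [this]
      field_simp
      linear_combination (2 * t:ℂ) * Complex.I_sq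
    · have e : (2 * (π:ℂ) * Complex.I * (Complex.I * t)) = ((-(2 * π * t) : ℝ) : ℂ) := by
        push_cast; linear_combination 2 * (π:ℂ) * t * Complex.I_sq
      rw [e, ← Complex.ofReal_exp, Real.exp_neg]
      unfold hh
      have hE : 1 < Real.exp (2 * π * t) := by
        apply Real.one_lt_exp_iff.2; positivity
      set E := Real.exp (2 * π * t)
      have hE0 : (E:ℂ) ≠ 0 := by exact_mod_cast (by linarith : E ≠ 0)
      have hE1 : (E:ℂ) - 1 ≠ 0 := by exact_mod_cast (by linarith : E - 1 ≠ 0)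
      have hI := Complex.I_ne_zero
      push_cast
      have : (1 - (E:ℂ)⁻¹) = (E - 1) / E := by field_simp
      rw [this]
      field_simp
      ring
  · have hsum : Summable (fun k : ℕ => (2 * π * t) * (2 * π)⁻¹ ^ 2 * (1 / ((k:ℝ) + 1) ^ 2)) := by
      apply Summable.mul_left
      exact_mod_cast (summable_nat_add_iff 1).2 (Real.summable_one_div_nat_pow.2 (by norm_num : 1 < 2))
    refine Summable.of_nonneg_of_le (fun k => integral_nonneg fun _ => norm_nonneg _) ?_ hsum
    intro k
    have hc : 0 < 2 * π * ((k:ℝ) + 1) := by positivity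
    have hi := Real.integral_rpow_mul_exp_neg_mul_Ioi (a := 2) (by norm_num) hc
    have hii : IntegrableOn (fun y : ℝ => y ^ (1:ℝ) * Real.exp (-(2 * π * ((k:ℝ) + 1)) * y ^ (1:ℝ))) (Set.Ioi 0) :=
      integrableOn_rpow_mul_exp_neg_mul_rpow (by norm_num) (by norm_num) hc
    calc _ ≤ ∫ y in Set.Ioi (0:ℝ), (2 * π * t) * (y ^ (1:ℝ) * Real.exp (-(2 * π * ((k:ℝ) + 1)) * y ^ (1:ℝ))) := by
          apply setIntegral_mono_on (int_sin_exp t _ hc).1.norm (hii.const_mul _) measurableSet_Ioi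
          intro y hy
          have hy : 0 < y := hy
          rw [norm_mul, Real.norm_eq_abs, Real.norm_of_nonneg (Real.exp_pos _).le, Real.rpow_one, ← mul_assoc]
          gcongr
          refine Real.abs_sin_le_abs.trans ?_
          rw [abs_of_pos (by positivity)]
      _ = _ := by
          rw [integral_const_mul]
          norm_num [Real.Gamma_two] at hi
          simp only [Real.rpow_one, neg_mul]
          rw [hi]
          field_simp

lemma gauss_sin (s : ℂ) (hs : 0 < s.re) (y : ℝ) :
    ∫ t in Set.Ioi (0:ℝ), (t : ℂ) * Complex.exp (-(π * s) * t ^ 2) * (Real.sin (2 * π * t * y) : ℝ)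
      = y / (2 * s) * (1 / s) ^ (1 / 2 : ℂ) * Complex.exp (-(π * (1 / s)) * y ^ 2) := by
  have hb : 0 < ((π : ℂ) * s).re := by
    rw [Complex.re_ofReal_mul]; positivity
  have hs0 : s ≠ 0 := by rintro rfl; simp at hs
  have hpc : (π : ℂ) ≠ 0 := by exact_mod_cast Real.pi_ne_zero
  have hF := fourierIntegral_gaussian hb (2 * π * y)
  set f : ℝ → ℂ := fun t => Complex.exp (Complex.I * (2 * π * y) * t) * Complex.exp (-(π * s) * t ^ 2) with hf
  have hn : ∀ t : ℝ, ‖Complex.exp (Complex.I * (2 * π * y) * t)‖ = 1 := by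
    intro t
    have : Complex.I * (2 * π * y) * t = ((2 * π * y * t : ℝ) : ℂ) * Complex.I := by push_cast; ring
    rw [this, Complex.norm_exp_ofReal_mul_I]
  have hfi : Integrable f := by
    refine (integrable_cexp_neg_mul_sq hb).mono (by apply Continuous.aestronglyMeasurable; fun_prop) ?_
    refine Filter.Eventually.of_forall fun t => ?_
    simp only [hf, norm_mul, hn, one_mul, le_refl]
  have htf : Integrable (fun t : ℝ => (t : ℂ) * f t) := by
    refine (integrable_mul_cexp_neg_mul_sq hb).mono (by apply Continuous.aestronglyMeasurable; fun_prop) ?_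
    refine Filter.Eventually.of_forall fun t => ?_
    simp only [hf, norm_mul, hn, one_mul, le_refl]
  have hd : ∀ t : ℝ, HasDerivAt f (Complex.I * (2 * π * y) * f t - 2 * (π * s) * (t * f t)) t := by
    intro t
    have h1 : HasDerivAt (fun t : ℂ => Complex.exp (Complex.I * (2 * π * y) * t) * Complex.exp (-(π * s) * t ^ 2))
        (Complex.exp (Complex.I * (2 * π * y) * t) * (Complex.I * (2 * π * y) * 1) * Complex.exp (-(π * s) * t ^ 2)
          + Complex.exp (Complex.I * (2 * π * y) * t) * (Complex.exp (-(π * s) * t ^ 2) * (-(π * s) * (((2:ℕ):ℂ) * (t:ℂ) ^ (2 - 1))))) (t:ℂ) :=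
      (((hasDerivAt_id _).const_mul _).cexp).mul ((((hasDerivAt_pow 2 _).const_mul _)).cexp)
    convert h1.comp_ofReal using 1
    simp only [hf]; push_cast; ring
  have h0 := integral_eq_zero_of_hasDerivAt_of_integrable hd
    ((hfi.const_mul _).sub (htf.const_mul _)) hfi
  rw [integral_sub (hfi.const_mul _) (htf.const_mul _), integral_const_mul, integral_const_mul, hF] at h0
  have hsplit : ∫ t : ℝ, (t:ℂ) * f t = 2 * Complex.I * 
      ∫ t in Set.Ioi (0:ℝ), (t : ℂ) * Complex.exp (-(π * s) * t ^ 2) * (Real.sin (2 * π * t * y) : ℝ) := by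
    rw [← integral_add_compl (s := Set.Ioi (0:ℝ)) measurableSet_Ioi htf, Set.compl_Ioi]
    have := integral_comp_neg_Ioi 0 (fun t : ℝ => (t:ℂ) * f t)
    rw [neg_zero] at this
    rw [← this, ← integral_add htf.integrableOn htf.comp_neg.integrableOn, ← integral_const_mul]
    congr 1
    funext t
    simp only [hf]
    push_cast
    rw [Complex.sin]
    have e1 : Complex.I * (2 * π * y) * t = 2 * π * t * y * Complex.I := by ring
    have e2 : Complex.I * (2 * π * y) * -t = -(2 * π * t * y) * Complex.I := by ring
    rw [e1, e2, neg_sq]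
    linear_combination (t:ℂ) * Complex.exp (-(π * s) * t ^ 2) * (Complex.exp (2 * π * t * y * Complex.I) - Complex.exp (-(2 * π * t * y) * Complex.I)) * Complex.I_sq
  rw [hsplit] at h0
  have e3 : (π:ℂ) / (π * s) = 1 / s := by field_simp
  have e4 : -(2 * (π:ℂ) * y)^2 / (4 * (π * s)) = -(π * (1 / s)) * y ^ 2 := by field_simp; ring
  rw [e3, e4] at h0
  have hI := Complex.I_ne_zero
  set J := ∫ t in Set.Ioi (0:ℝ), (t : ℂ) * Complex.exp (-(π * s) * t ^ 2) * (Real.sin (2 * π * t * y) : ℝ)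
  have : J * (4 * π * s * Complex.I) = (y / (2 * s) * (1 / s) ^ (1 / 2 : ℂ) * Complex.exp (-(π * (1 / s)) * y ^ 2)) * (4 * π * s * Complex.I) := by
    set W := (1 / s) ^ (1 / 2 : ℂ)
    set X := Complex.exp (-(π * (1 / s)) * y ^ 2)
    have : (y / (2 * s) * W * X) * (4 * π * s * Complex.I) = 2 * π * y * W * X * Complex.I := by
      field_simp; ring
    rw [this]
    linear_combination - h0
  exact mul_right_cancel₀ (by simp [hpc, hs0]) this

noncomputable def HH (s : ℂ) : ℂ :=
  ∫ t in Set.Ioi (0:ℝ), (t : ℂ) * Complex.exp (-(π * s) * t ^ 2) * (hh t : ℝ)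

lemma norm_gauss (s : ℂ) (t : ℝ) :
    ‖Complex.exp (-(π * s) * t ^ 2)‖ = Real.exp (-(π * s.re) * t ^ 2) := by
  rw [Complex.norm_exp]
  congr 1
  have : -(π * s) * (t:ℂ) ^ 2 = ((- π * t ^ 2 : ℝ) : ℂ) * s := by push_cast; ring
  rw [this, Complex.re_ofReal_mul]; ring

lemma HH_int (s : ℂ) (hs : 0 ≤ s.re) : 
    IntegrableOn (fun t : ℝ => (t : ℂ) * Complex.exp (-(π * s) * t ^ 2) * (hh t : ℝ)) (Set.Ioi 0) := by
  have := hh_meas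
  refine Integrable.mono' hh_int (Measurable.aestronglyMeasurable (by fun_prop)) ?_
  filter_upwards [ae_restrict_mem measurableSet_Ioi] with t ht
  have ht : 0 < t := ht
  have h1 := hh_pos ht
  rw [norm_mul, norm_mul, norm_gauss, Complex.norm_of_nonneg ht.le, Complex.norm_of_nonneg h1.le]
  have : Real.exp (-(π * s.re) * t ^ 2) ≤ 1 := by
    apply Real.exp_le_one_iff.2
    have : 0 ≤ π * s.re * t ^ 2 := by positivity
    linarith
  calc _ ≤ t * 1 * hh t := by gcongr
    _ = _ := by ring

lemma HH_func (s : ℂ) (hs : 0 < s.re) :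
    1 / s * (1 / s) ^ (1 / 2 : ℂ) * HH (1 / s)
      = 1 / (4 * π * s) + HH s - (1 / s) ^ (1 / 2 : ℂ) / (4 * π) := by
  have hb : 0 < ((π : ℂ) * s).re := by
    rw [Complex.re_ofReal_mul]; positivity
  have hs0 : s ≠ 0 := by rintro rfl; simp at hs
  have hpc : (π : ℂ) ≠ 0 := by exact_mod_cast Real.pi_ne_zero
  have hm := hh_meas
  have hswap := integral_integral_swap
    (μ := volume.restrict (Set.Ioi (0:ℝ))) (ν := volume.restrict (Set.Ioi (0:ℝ)))
    (f := fun (y t : ℝ) => (t : ℂ) * Complex.exp (-(π * s) * t ^ 2) * (Real.sin (2 * π * t * y) : ℝ) * (hh y : ℝ)) ?_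
  · have hL : ∫ y in Set.Ioi (0:ℝ), ∫ t in Set.Ioi (0:ℝ), (t : ℂ) * Complex.exp (-(π * s) * t ^ 2) * (Real.sin (2 * π * t * y) : ℝ) * (hh y : ℝ)
        = (1 / s * (1 / s) ^ (1 / 2 : ℂ) * HH (1 / s)) / 2 := by
      simp_rw [integral_mul_const, gauss_sin s hs]
      rw [HH, mul_div_right_comm, ← integral_const_mul]
      congr 1
      funext y
      field_simp
    have hR : ∫ t in Set.Ioi (0:ℝ), ∫ y in Set.Ioi (0:ℝ), (t : ℂ) * Complex.exp (-(π * s) * t ^ 2) * (Real.sin (2 * π * t * y) : ℝ) * (hh y : ℝ)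
        = ∫ t in Set.Ioi (0:ℝ), ((1 / 4 : ℂ) * (t * Complex.exp (-(π * s) * t ^ 2)) 
            + (1 / 2 : ℂ) * ((t : ℂ) * Complex.exp (-(π * s) * t ^ 2) * (hh t : ℝ))
            - (1 / (4 * π) : ℂ) * Complex.exp (-(π * s) * t ^ 2)) := by
      apply setIntegral_congr_fun measurableSet_Ioi
      intro t ht
      have ht : 0 < t := ht
      have htc : (t : ℂ) ≠ 0 := by exact_mod_cast ht.ne'
      simp only
      simp_rw [mul_assoc _ ((Real.sin _ : ℝ) : ℂ) _, ← Complex.ofReal_mul]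
      rw [integral_const_mul, integral_complex_ofReal, K_eq ht]
      push_cast
      field_simp
    rw [hL, hR] at hswap
    have i1 : IntegrableOn (fun t : ℝ => (t * Complex.exp (-(π * s) * t ^ 2))) (Set.Ioi 0) :=
      (integrable_mul_cexp_neg_mul_sq hb).integrableOn
    have i2 := HH_int s hs.le
    have i3 : IntegrableOn (fun t : ℝ => (Complex.exp (-(π * s) * t ^ 2))) (Set.Ioi 0) :=
      (integrable_cexp_neg_mul_sq hb).integrableOn
    rw [integral_sub (f := fun t : ℝ => (1 / 4 : ℂ) * (t * Complex.exp (-(π * s) * t ^ 2)) + (1 / 2 : ℂ) * ((t : ℂ) * Complex.exp (-(π * s) * t ^ 2) * (hh t : ℝ))) ((i1.const_mul _).add (i2.const_mul _)) (i3.const_mul _),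
      integral_add (i1.const_mul _) (i2.const_mul _), integral_const_mul, integral_const_mul, integral_const_mul,
      integral_mul_cexp_neg_mul_sq hb, integral_gaussian_complex_Ioi hb, ← HH] at hswap
    have e3 : (π:ℂ) / (π * s) = 1 / s := by field_simp
    rw [e3] at hswap
    rw [div_eq_iff two_ne_zero] at hswap
    rw [hswap]
    field_simp
  · have hb' : 0 < π * s.re := by positivity
    have g1 := (integrableOn_rpow_mul_exp_neg_mul_sq hb' (s := 2) (by norm_num)).const_mul (2 * π)
    refine Integrable.mono' (Integrable.mul_prod hh_int g1) (Measurable.aestronglyMeasurable (by unfold Function.uncurry; fun_prop)) ?_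
    rw [Measure.prod_restrict]
    filter_upwards [ae_restrict_mem (measurableSet_Ioi.prod measurableSet_Ioi)] with p hp
    obtain ⟨y, t⟩ := p
    obtain ⟨hy, ht⟩ := hp
    have hy : 0 < y := hy
    have ht : 0 < t := ht
    have h1 := hh_pos hy
    simp only [Function.uncurry]
    rw [norm_mul, norm_mul, norm_mul, norm_gauss, Complex.norm_of_nonneg ht.le, Complex.norm_of_nonneg h1.le, Complex.norm_real, Real.norm_eq_abs]
    have : |Real.sin (2 * π * t * y)| ≤ 2 * π * t * y := by
      refine Real.abs_sin_le_abs.trans ?_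
      rw [abs_of_pos (by positivity)]
    calc _ ≤ t * Real.exp (-(π * s.re) * t ^ 2) * (2 * π * t * y) * hh y := by gcongr
      _ = _ := by norm_num; ring

lemma HH_tendsto (σ : ℝ → ℂ) (s₀ : ℂ) (l : Filter ℝ) [l.IsCountablyGenerated]
    (hσ : Filter.Tendsto σ l (nhds s₀)) (h0 : ∀ᶠ e in l, 0 ≤ (σ e).re) :
    Filter.Tendsto (fun e => HH (σ e)) l (nhds (HH s₀)) := by
  have hm := hh_meas
  unfold HH
  refine tendsto_integral_filter_of_dominated_convergence (fun t => t * hh t) ?_ ?_ hh_int ?_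
  · exact Filter.Eventually.of_forall fun e => Measurable.aestronglyMeasurable (by fun_prop)
  · filter_upwards [h0] with e he
    filter_upwards [ae_restrict_mem measurableSet_Ioi] with t ht
    have ht : 0 < t := ht
    have h1 := hh_pos ht
    rw [norm_mul, norm_mul, norm_gauss, Complex.norm_of_nonneg ht.le, Complex.norm_of_nonneg h1.le]
    have : Real.exp (-(π * (σ e).re) * t ^ 2) ≤ 1 := by
      apply Real.exp_le_one_iff.2
      have : 0 ≤ π * (σ e).re * t ^ 2 := by positivity
      linarith
    calc _ ≤ t * 1 * hh t := by gcongr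
      _ = _ := by ring
  · refine Filter.Eventually.of_forall fun t => ?_
    have hc : Continuous (fun z : ℂ => (t : ℂ) * Complex.exp (-(π * z) * t ^ 2) * (hh t : ℝ)) := by fun_prop
    exact (hc.tendsto s₀).comp hσ

noncomputable def Sn (a : ℝ) : ℝ :=
  ∫ x in Set.Ioi (0:ℝ), Real.sin (π * a * x) / (Real.exp (2 * π * Real.sqrt x) - 1)

lemma chg (g : ℝ → ℝ) :
    ∫ x in Set.Ioi (0:ℝ), g x / (Real.exp (2 * π * Real.sqrt x) - 1)
      = 2 * ∫ t in Set.Ioi (0:ℝ), t * g (t ^ 2) * hh t := by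
  rw [← integral_comp_rpow_Ioi_of_pos (p := 2) (by norm_num), ← integral_const_mul]
  apply setIntegral_congr_fun measurableSet_Ioi
  intro t ht
  have ht : 0 < t := ht
  have e : Real.sqrt (t ^ (2:ℝ)) = t := by
    rw [Real.rpow_two]; exact Real.sqrt_sq ht.le
  simp only [smul_eq_mul]
  rw [e, Real.rpow_two]
  norm_num [hh]
  ring

lemma HH_I (c : ℝ) : HH (Complex.I * c) = (Phi3 c - Complex.I * Sn c) / 2 := by
  have hi := HH_int (Complex.I * c) (by simp)
  have hx : ∀ t : ℝ, (t : ℂ) * Complex.exp (-(π * (Complex.I * c)) * t ^ 2) * (hh t : ℝ)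
      = ((t * Real.cos (π * c * t ^ 2) * hh t : ℝ) : ℂ) - Complex.I * ((t * Real.sin (π * c * t ^ 2) * hh t : ℝ) : ℂ) := by
    intro t
    have : -((π:ℂ) * (Complex.I * c)) * t ^ 2 = (-(π * c * t ^ 2)) * Complex.I := by ring
    rw [this, Complex.exp_mul_I, Complex.cos_neg, Complex.sin_neg]
    push_cast
    ring
  have h1 := integral_re hi
  have h2 := integral_im hi
  simp only [hx] at h1 h2
  unfold Phi3 Sn
  rw [chg (fun x => Real.cos (π * c * x)), chg (fun x => Real.sin (π * c * x))]
  unfold HH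
  simp only [hx]
  apply Complex.ext
  · rw [← RCLike.re_to_complex, ← h1]
    simp [-Complex.ofReal_mul, -Complex.ofReal_cos, -Complex.ofReal_sin, integral_neg]
  · rw [← RCLike.im_to_complex, ← h2]
    simp [-Complex.ofReal_mul, -Complex.ofReal_cos, -Complex.ofReal_sin, integral_neg]
    ring

lemma sqrt_val (a : ℝ) (ha : 0 < a) :
    (Complex.I / a) ^ (1 / 2 : ℂ) = (1 + Complex.I) / 2 * (Real.sqrt (2 / a) : ℝ) := by
  have h2 : ((Real.sqrt (2 / a) : ℝ) : ℂ) ^ 2 = 2 / a := by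
    rw [← Complex.ofReal_pow, Real.sq_sqrt (by positivity)]; push_cast; rfl
  have hr : 0 < Real.sqrt (2 / a) := Real.sqrt_pos.2 (by positivity)
  have hsq : Complex.I / a = ((1 + Complex.I) / 2 * (Real.sqrt (2 / a) : ℝ)) ^ 2 := by
    rw [mul_pow, h2]
    linear_combination (-1 / (2 * (a:ℂ))) * Complex.I_sq
  have harg : ((1 + Complex.I) / 2 * (Real.sqrt (2 / a) : ℝ)).arg = π / 4 := by
    have : ((1 + Complex.I) / 2 * (Real.sqrt (2 / a) : ℝ)) = 
      ((Real.sqrt (2 / a) / Real.sqrt 2 : ℝ) : ℂ) * (Complex.cos ((π/4 : ℝ)) + Complex.sin ((π/4 : ℝ)) * Complex.I) := by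
      rw [← Complex.ofReal_cos, ← Complex.ofReal_sin, Real.cos_pi_div_four, Real.sin_pi_div_four]
      have h : ((Real.sqrt 2 : ℝ) : ℂ) ≠ 0 := by 
        exact_mod_cast (Real.sqrt_pos.2 (by norm_num : (0:ℝ) < 2)).ne'
      push_cast
      field_simp
    rw [this, Complex.arg_mul_cos_add_sin_mul_I (by positivity)]
    constructor <;> linarith [Real.pi_pos]
  rw [hsq]
  have := Complex.pow_cpow_nat_inv (x := (1 + Complex.I) / 2 * (Real.sqrt (2 / a) : ℝ)) (n := 2) (by norm_num)
    (by rw [harg]; norm_num; linarith [Real.pi_pos]) (by rw [harg]; norm_num; linarith [Real.pi_pos])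
  rw [one_div]
  exact_mod_cast this

lemma HH_bdry (a : ℝ) (ha : 0 < a) :
    Complex.I / a * (Complex.I / a) ^ (1 / 2 : ℂ) * HH (Complex.I / a)
      = Complex.I / a * (1 / (4 * π)) + HH (-Complex.I * a) - (Complex.I / a) ^ (1 / 2 : ℂ) / (4 * π) := by
  have hac : (a : ℂ) ≠ 0 := by exact_mod_cast ha.ne'
  set σ : ℝ → ℂ := fun e => e - Complex.I * a with hσ
  set l := nhdsWithin (0:ℝ) (Set.Ioi 0)
  have hre : ∀ e, (σ e).re = e := by intro e; simp [hσ]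
  have t1 : Filter.Tendsto σ l (nhds (-Complex.I * a)) := by
    have : Continuous σ := by fun_prop
    have h := this.tendsto 0
    have e : σ 0 = -Complex.I * a := by simp [hσ]
    rw [e] at h
    exact h.mono_left nhdsWithin_le_nhds
  have hinv : 1 / (-Complex.I * a) = Complex.I / a := by
    rw [div_eq_div_iff (by simp [hac]) hac]
    linear_combination (a:ℂ) * Complex.I_sq
  have t2 : Filter.Tendsto (fun e => 1 / σ e) l (nhds (Complex.I / a)) := by
    rw [← hinv]
    exact tendsto_const_nhds.div t1 (by simp [hac])
  have hpos : ∀ᶠ e in l, 0 < e := self_mem_nhdsWithin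
  have t3 := HH_tendsto σ _ l t1 (by filter_upwards [hpos] with e he; rw [hre]; exact he.le)
  have t4 := HH_tendsto (fun e => 1 / σ e) _ l t2 (by
    filter_upwards [hpos] with e he
    rw [one_div, Complex.inv_re, hre]
    exact div_nonneg he.le (Complex.normSq_nonneg _))
  have t5 : Filter.Tendsto (fun e => (1 / σ e) ^ (1 / 2 : ℂ)) l (nhds ((Complex.I / a) ^ (1 / 2 : ℂ))) := by
    refine t2.cpow tendsto_const_nhds ?_
    right
    have : Complex.I / (a:ℂ) = ((a⁻¹ : ℝ) : ℂ) * Complex.I := by push_cast; field_simp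
    rw [this]; simp [ha.ne']
  have L := (t2.mul t5).mul t4
  have R := ((t2.mul_const (1 / (4 * π) : ℂ)).add t3).sub (t5.div_const (4 * π : ℂ))
  refine tendsto_nhds_unique (L.congr' ?_) R
  filter_upwards [hpos] with e he
  rw [HH_func (σ e) (by rw [hre]; exact he)]
  have h0 : σ e ≠ 0 := by intro h; have := hre e; rw [h] at this; simp at this; linarith
  have hpc : (π : ℂ) ≠ 0 := by exact_mod_cast Real.pi_ne_zero
  congr 2
  field_simp

theorem stmt5 (n : ℝ) (hn : 0 < n) :
    Psi3 n = (1 / n) * Real.sqrt (2 / n) * Phi3 (1 / n) + Phi3 n := by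
  have h := HH_bdry n hn
  have hP : Psi3 n = 1 / (2 * π * n) + Sn n := rfl
  have e1 : Complex.I / n = Complex.I * ((1 / n : ℝ) : ℂ) := by push_cast; ring
  have e2 : -Complex.I * n = Complex.I * ((-n : ℝ) : ℂ) := by push_cast; ring
  have p1 : Phi3 (-n) = Phi3 n := by
    unfold Phi3; simp
  have p2 : Sn (-n) = - Sn n := by
    unfold Sn; rw [← integral_neg]; congr 1; funext x
    rw [mul_neg, neg_mul, Real.sin_neg, neg_div]
  rw [sqrt_val n hn, e1, e2, HH_I, HH_I, p1, p2] at h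
  set r := Real.sqrt (2 / n)
  have hre := congrArg Complex.re h
  have him := congrArg Complex.im h
  have hpr : (1 / (4 * π) : ℂ) = ((1 / (4 * π) : ℝ) : ℂ) := by push_cast; rfl
  rw [hP]
  have key : ∀ X Y : ℂ, X = Y → X.im - X.re = Y.im - Y.re := by rintro _ _ rfl; rfl
  have h' : (((1 / n * r * (-(Phi3 (1 / n)) + Sn (1 / n)) / 4 : ℝ) : ℂ) + ((1 / n * r * (Phi3 (1 / n) + Sn (1 / n)) / 4 : ℝ) : ℂ) * Complex.I)
      = ((Phi3 n / 2 - r / (8 * π) : ℝ) : ℂ) + ((1 / (4 * π * n) + Sn n / 2 - r / (8 * π) : ℝ) : ℂ) * Complex.I := by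
    have hpc : (π : ℂ) ≠ 0 := by exact_mod_cast Real.pi_ne_zero
    have hnc : (n : ℂ) ≠ 0 := by exact_mod_cast hn.ne'
    push_cast at h ⊢
    field_simp at h ⊢
    ring_nf at h ⊢
    simp only [Complex.I_sq, show Complex.I ^ 3 = -Complex.I by rw [pow_succ, Complex.I_sq]; ring] at h ⊢
    linear_combination 4 * h
  have h3 := key _ _ h'
  simp only [Complex.add_im, Complex.add_re, Complex.ofReal_im, Complex.ofReal_re, Complex.mul_re, Complex.mul_im, Complex.I_re, Complex.I_im] at h3
  have : 1 / (2 * π * n) = 2 * (1 / (4 * π * n)) := by field_simp; norm_num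
  rw [this]
  linarith
end
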